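/- arXiv:2508.09739 — 4 statements merged into one kernel-verified Lean document; each statement's English description precedes it below -/
import Mathlib

section
/- Let p be a prime, k a field of characteristic p, and F any field. Then every continuous homomorphism ρ : Gal(F_s/F) → GL_2(k) admits a lift to a continuous homomorphism ρ₂ : Gal(F_s/F) → GL_2(W_2(k)) along the reduction W_2(k) → k, i.e. the map H^1(Gal(F_s/F), GL_2(W_2(k))) → H^1(Gal(F_s/F), GL_2(k)) is surjective. -/
open scoped MatrixGroups

/-- The canonical reduction `W₂(k) → k` on length-2 truncated Witt vectors. -/
noncomputable def wittRed (p : ℕ) [Fact p.Prime] (k : Type) [CommRing k] :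
    TruncatedWittVector p 2 k →+* k :=
  RingHom.liftOfRightInverse (WittVector.truncate 2) TruncatedWittVector.out
    TruncatedWittVector.truncateFun_out
    ⟨WittVector.constantCoeff, by
      intro x hx
      rw [WittVector.mem_ker_truncate] at hx
      simpa [RingHom.mem_ker] using hx 0 (by norm_num)⟩

/-- The absolute Galois group `Gal(F_s/F)`, with its Krull topology. -/
abbrev AbsGal (F : Type) [Field F] : Type :=
  SeparableClosure F ≃ₐ[F] SeparableClosure F

theorem exists_lift_of_lift_subgroup {G E Q : Type*} [Group G] [Group E] [Group Q]
    [TopologicalSpace G] [IsTopologicalGroup G] [CompactSpace G] [TotallyDisconnectedSpace G]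
    (π : E →* Q) (hπ : Function.Surjective π) {p : ℕ} (hp : p.Prime)
    (hcomm : ∀ a b : π.ker, a * b = b * a) (hpow : ∀ a : π.ker, a ^ p = 1)
    (ρ : G →* Q) (hρ : IsOpen (ρ.ker : Set G))
    (H : Subgroup G) (hH : IsOpen (H : Set G)) (hindex : ¬ p ∣ H.index)
    (τ : H →* E) (hτ : ∀ h : H, π (τ h) = ρ h)
    (U : Subgroup G) (hU : IsOpen (U : Set G)) (hτU : ∀ h : H, (h : G) ∈ U → τ h = 1) :
    ∃ ρ₂ : G →* E, IsOpen (ρ₂.ker : Set G) ∧ π.comp ρ₂ = ρ := by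
  let _ : CommGroup π.ker := { (inferInstance : Group π.ker) with mul_comm := hcomm }
  have : Finite (G ⧸ H) := H.quotient_finite_of_isOpen hH
  have : Fintype (G ⧸ H) := Fintype.ofFinite _
  obtain ⟨s, hs⟩ := hπ.hasRightInverse
  let Γ : Subgroup (G × E) := (π.comp (MonoidHom.snd G E)).eqLocus (ρ.comp (MonoidHom.fst G E))
  have hΓ (γ : Γ) : π γ.1.2 = ρ γ.1.1 := γ.2
  let r (x : G ⧸ H) : G := x.out
  have hr (x : G ⧸ H) : (r x : G ⧸ H) = x := Quotient.out_eq _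
  let e (x : G ⧸ H) : E := s (ρ (r x))
  have he (x : G ⧸ H) : π (e x) = ρ (r x) := hs _
  have hmem (g : G) (x : G ⧸ H) : (r (g • x))⁻¹ * (g * r x) ∈ H := by
    rw [← QuotientGroup.eq, hr]
    conv_lhs => rw [← hr x]
    rfl
  let j (g : G) (x : G ⧸ H) : H := ⟨_, hmem g x⟩
  have hj_mul (g g' : G) (x : G ⧸ H) : j (g * g') x = j g (g' • x) * j g' x := by
    apply Subtype.ext
    simp only [j, Subgroup.coe_mul, mul_smul]
    group
  let ψ (γ : Γ) (x : G ⧸ H) : π.ker :=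
    ⟨γ.1.2 * e x * (τ (j γ.1.1 x))⁻¹ * (e (γ.1.1 • x))⁻¹, by
      rw [MonoidHom.mem_ker]
      simp only [map_mul, map_inv, hΓ, he, hτ, j]
      group⟩
  have hψ_mul (γ δ : Γ) (x : G ⧸ H) :
      ψ (γ * δ) x = ψ γ (δ.1.1 • x) * MulAut.conjNormal γ.1.2 (ψ δ x) := by
    rw [hcomm]
    apply Subtype.ext
    simp only [ψ, Subgroup.coe_mul, Prod.fst_mul, Prod.snd_mul, MulAut.conjNormal_apply, hj_mul,
      map_mul, mul_smul]
    group
  let φ (γ : Γ) : π.ker := ∏ x, ψ γ x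
  have hφ_mul (γ δ : Γ) : φ (γ * δ) = φ γ * MulAut.conjNormal γ.1.2 (φ δ) := by
    simp only [φ, hψ_mul, Finset.prod_mul_distrib, map_prod]
    congr 1
    exact Equiv.prod_comp (MulAction.toPerm δ.1.1) (ψ γ)
  let ι (a : π.ker) : Γ := ⟨(1, a), by
    change π a = ρ 1
    rw [map_one]
    exact a.2⟩
  have hφι (a : π.ker) : φ (ι a) = a ^ H.index := by
    have h1 (x : G ⧸ H) : ψ (ι a) x = a := by
      have hj1 : j 1 x = 1 := Subtype.ext (by simp [j])
      apply Subtype.ext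
      simp [ψ, ι, hj1]
    simp only [φ, h1, Finset.prod_const, Finset.card_univ, Subgroup.index, Nat.card_eq_fintype_card]
  obtain ⟨c, hc⟩ : ∃ c, H.index * c % p = 1 := by
    obtain ⟨c, -, hc⟩ := Nat.exists_mul_mod_eq_one_of_coprime
      ((hp.coprime_iff_not_dvd.mpr hindex).symm) hp.one_lt
    exact ⟨c, hc⟩
  have hc' (a : π.ker) : (a ^ H.index) ^ c = a := by
    rw [← pow_mul, pow_eq_pow_mod _ (hpow a), hc, pow_one]
  let σ : Γ →* E := MonoidHom.mk' (fun γ ↦ (((φ γ) ^ c)⁻¹ : π.ker) * γ.1.2) (fun γ δ ↦ by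
    have : ((φ (γ * δ)) ^ c)⁻¹ = ((φ γ) ^ c)⁻¹ * MulAut.conjNormal γ.1.2 ((φ δ) ^ c)⁻¹ := by
      rw [hφ_mul, mul_pow, mul_inv, map_inv, map_pow]
    rw [this]
    simp only [Subgroup.coe_mul, MulAut.conjNormal_apply, Prod.snd_mul]
    group)
  have hσι (a : π.ker) : σ (ι a) = 1 := by
    change (((φ (ι a)) ^ c)⁻¹ : π.ker) * (a : E) = 1
    rw [hφι, hc']
    simp
  have hσ_eq (γ δ : Γ) (h : γ.1.1 = δ.1.1) : σ γ = σ δ := by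
    have hk : γ.1.2 * δ.1.2⁻¹ ∈ π.ker := by
      rw [MonoidHom.mem_ker, map_mul, map_inv, hΓ, hΓ, h, mul_inv_cancel]
    have : γ = ι ⟨_, hk⟩ * δ := by
      apply Subtype.ext
      apply Prod.ext
      · simp [ι, h]
      · simp [ι]
    rw [this, map_mul, hσι, one_mul]
  let lift (g : G) : Γ := ⟨(g, s (ρ g)), hs _⟩
  let ρ₂ : G →* E := MonoidHom.mk' (fun g ↦ σ (lift g)) (fun g g' ↦ by
    rw [← map_mul]
    exact hσ_eq _ _ rfl)
  refine ⟨ρ₂, ?_, ?_⟩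
  · obtain ⟨N, hN⟩ := ProfiniteGrp.exist_openNormalSubgroup_sub_open_nhds_of_one
      ((hρ.inter hU).inter hH) ⟨⟨one_mem _, one_mem _⟩, one_mem _⟩
    refine Subgroup.isOpen_mono (H₁ := N.toSubgroup) (fun n hn ↦ ?_) N.isOpen
    have hnρ : ρ n = 1 := (hN hn).1.1
    have hconj (x : G ⧸ H) : (r x)⁻¹ * (n * r x) ∈ N.toSubgroup := by
      have := N.isNormal'.conj_mem n hn (r x)⁻¹
      simpa [mul_assoc] using this
    have hnx (x : G ⧸ H) : n • x = x := by
      conv_rhs => rw [← hr x]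
      conv_lhs => rw [← hr x]
      change ((n * r x : G) : G ⧸ H) = _
      rw [eq_comm, QuotientGroup.eq]
      exact (hN (hconj x)).2
    let γ : Γ := ⟨(n, 1), by change π 1 = ρ n; rw [map_one, hnρ]⟩
    have hγ (x : G ⧸ H) : ψ γ x = 1 := by
      have : τ (j n x) = 1 := by
        apply hτU
        change (r (n • x))⁻¹ * (n * r x) ∈ U
        rw [hnx]
        exact (hN (hconj x)).1.2
      apply Subtype.ext
      simp [ψ, γ, this, hnx]
    rw [MonoidHom.mem_ker]
    change σ (lift n) = 1
    rw [hσ_eq (lift n) γ rfl]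
    change (((φ γ) ^ c)⁻¹ : π.ker) * (1 : E) = 1
    simp [φ, hγ]
  · ext g
    change π ((((φ (lift g)) ^ c)⁻¹ : π.ker) * s (ρ g)) = ρ g
    rw [map_mul, hs, (((φ (lift g)) ^ c)⁻¹ : π.ker).2, one_mul]

section Hilbert90

variable {F K : Type*} [Field F] [Field K] [Algebra F K] [IsGalois F K]

theorem sum_out_mul_left {H M : Type*} [Group H] [AddCommMonoid M] (N : Subgroup H)
    [Fintype (H ⧸ N)] (t : H → M) (ht : ∀ h, ∀ n ∈ N, t (h * n) = t h) (h : H) :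
    ∑ q : H ⧸ N, t (h * q.out) = ∑ q : H ⧸ N, t q.out := by
  rw [← Equiv.sum_comp (MulAction.toPerm h) (fun q : H ⧸ N ↦ t q.out)]
  refine Finset.sum_congr rfl fun q _ ↦ ?_
  have hq : ((h * q.out : H) : H ⧸ N) = (h • q).out := by
    rw [QuotientGroup.out_eq', ← smul_eq_mul, ← MulAction.Quotient.smul_coe,
      QuotientGroup.out_eq']
  rw [QuotientGroup.eq] at hq
  rw [MulAction.toPerm_apply, ← ht _ _ hq, mul_inv_cancel_left]

theorem exists_sum_out_mul_ne_zero (H N : Subgroup Gal(K/F)) (hN : IsOpen (N : Set Gal(K/F)))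
    [Fintype (H ⧸ N.subgroupOf H)] (f : H ⧸ N.subgroupOf H → K) (hf : f ≠ 0) :
    ∃ θ : K, (∀ n ∈ N, n θ = θ) ∧
      ∑ q : H ⧸ N.subgroupOf H, f q * (q.out : Gal(K/F)) θ ≠ 0 := by
  let L := IntermediateField.fixedField N
  let m (q : H ⧸ N.subgroupOf H) : L →* K :=
    (((q.out : Gal(K/F)) : K →ₐ[F] K).comp L.val : L →* K)
  have hm : Function.Injective m := by
    intro q q' hqq
    have hmem : ((q.out : H) : Gal(K/F))⁻¹ * (q'.out : Gal(K/F)) ∈ L.fixingSubgroup := by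
      rw [IntermediateField.mem_fixingSubgroup_iff]
      intro x hx
      have := DFunLike.congr_fun hqq ⟨x, hx⟩
      change (q.out : Gal(K/F)) x = (q'.out : Gal(K/F)) x at this
      rw [AlgEquiv.mul_apply, ← this, ← AlgEquiv.mul_apply, inv_mul_cancel, AlgEquiv.one_apply]
    rw [InfiniteGalois.fixingSubgroup_fixedField ⟨N, N.isClosed_of_isOpen hN⟩] at hmem
    rw [← QuotientGroup.out_eq' q, ← QuotientGroup.out_eq' q', QuotientGroup.eq]
    exact Subgroup.mem_subgroupOf.mpr hmem
  have hli := (linearIndependent_monoidHom L K).comp m hm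
  by_contra! hcon
  apply hf
  rw [Fintype.linearIndependent_iff] at hli
  funext q
  refine hli f ?_ q
  funext θ
  simpa [m] using hcon θ fun n hn ↦ IntermediateField.mem_fixedField_iff _ _ |>.mp θ.2 n hn

theorem exists_smul_eq_mul_of_mul_cocycle (H N : Subgroup Gal(K/F))
    (hN : IsOpen (N : Set Gal(K/F)))
    (f : H → K) (hf0 : ∀ h, f h ≠ 0) (hf : ∀ h h' : H, f (h * h') = f h * (h : Gal(K/F)) (f h'))
    (hfN : ∀ h : H, (h : Gal(K/F)) ∈ N → f h = 1) :
    ∃ x : K, x ≠ 0 ∧ ∀ h : H, (h : Gal(K/F)) x = f h * x := by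
  have : Finite (Gal(K/F) ⧸ N) := N.quotient_finite_of_isOpen hN
  have : N.FiniteIndex := Subgroup.finiteIndex_of_finite_quotient
  have : Fintype (H ⧸ N.subgroupOf H) := Fintype.ofFinite _
  obtain ⟨θ, hθ, hne⟩ := exists_sum_out_mul_ne_zero H N hN (fun q ↦ f q.out)
    (fun h ↦ hf0 _ (congr_fun h ((1 : H) : H ⧸ N.subgroupOf H)))
  let t (h : H) : K := f h * (h : Gal(K/F)) θ
  have ht : ∀ h, ∀ n ∈ N.subgroupOf H, t (h * n) = t h := by
    intro h n hn
    simp only [t, hf, Subgroup.coe_mul, AlgEquiv.mul_apply]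
    rw [hfN n hn, hθ n hn, map_one, mul_one]
  refine ⟨(∑ q : H ⧸ N.subgroupOf H, t q.out)⁻¹, inv_ne_zero hne, fun h ↦ ?_⟩
  have hsum : (h : Gal(K/F)) (∑ q : H ⧸ N.subgroupOf H, t q.out) =
      (f h)⁻¹ * ∑ q : H ⧸ N.subgroupOf H, t q.out := by
    conv_rhs => rw [← sum_out_mul_left _ t ht h]
    rw [map_sum, Finset.mul_sum]
    refine Finset.sum_congr rfl fun q _ ↦ ?_
    simp only [t, hf h, map_mul, Subgroup.coe_mul, AlgEquiv.mul_apply]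
    rw [mul_assoc, inv_mul_cancel_left₀ (hf0 h)]
  rw [map_inv₀, hsum, mul_inv, inv_inv]

theorem exists_smul_eq_add_of_add_cocycle (H N : Subgroup Gal(K/F))
    (hN : IsOpen (N : Set Gal(K/F)))
    (f : H → K) (hf : ∀ h h' : H, f (h * h') = f h + (h : Gal(K/F)) (f h'))
    (hfN : ∀ h : H, (h : Gal(K/F)) ∈ N → f h = 0) :
    ∃ x : K, ∀ h : H, (h : Gal(K/F)) x = f h + x := by
  have : Finite (Gal(K/F) ⧸ N) := N.quotient_finite_of_isOpen hN
  have : N.FiniteIndex := Subgroup.finiteIndex_of_finite_quotient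
  have : Fintype (H ⧸ N.subgroupOf H) := Fintype.ofFinite _
  obtain ⟨θ, hθ, hne⟩ := exists_sum_out_mul_ne_zero H N hN (fun q ↦ 1)
    (fun h ↦ one_ne_zero (congr_fun h ((1 : H) : H ⧸ N.subgroupOf H)))
  simp only [one_mul] at hne
  let t (h : H) : K := f h * (h : Gal(K/F)) θ
  let u (h : H) : K := (h : Gal(K/F)) θ
  have hu : ∀ h, ∀ n ∈ N.subgroupOf H, u (h * n) = u h := by
    intro h n hn
    simp only [u, Subgroup.coe_mul, AlgEquiv.mul_apply]
    rw [hθ n hn]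
  have ht : ∀ h, ∀ n ∈ N.subgroupOf H, t (h * n) = t h := by
    intro h n hn
    simp only [t, hf, Subgroup.coe_mul, AlgEquiv.mul_apply]
    rw [hfN n hn, hθ n hn, map_zero, add_zero]
  set T : K := ∑ q : H ⧸ N.subgroupOf H, u q.out with hT
  have hTh (h : H) : (h : Gal(K/F)) T = T := by
    conv_rhs => rw [hT, ← sum_out_mul_left _ u hu h]
    rw [hT, map_sum]
    rfl
  refine ⟨-(∑ q : H ⧸ N.subgroupOf H, t q.out) / T, fun h ↦ ?_⟩
  have hsum : (h : Gal(K/F)) (∑ q : H ⧸ N.subgroupOf H, t q.out) =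
      (∑ q : H ⧸ N.subgroupOf H, t q.out) - f h * T := by
    conv_rhs => rw [hT, ← sum_out_mul_left _ t ht h, ← sum_out_mul_left _ u hu h]
    rw [map_sum, Finset.mul_sum, ← Finset.sum_sub_distrib]
    refine Finset.sum_congr rfl fun q _ ↦ ?_
    simp only [t, u, hf, map_mul, Subgroup.coe_mul, AlgEquiv.mul_apply]
    ring
  have hne' : T ≠ 0 := hne
  rw [map_div₀, map_neg, hsum, hTh]
  field_simp
  ring

end Hilbert90

/-- There is a locally constant character `χ : H → ℤ/p²`, trivial modulo `p`, such that every
locally constant homomorphism `H → ℤ/p` lifts to a locally constant `1`-cocycle with values in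
`ℤ/p²` twisted by `χ`. -/
def HasCyclotomicLifts {G : Type*} [Group G] [TopologicalSpace G] (p : ℕ) (H : Subgroup G) :
    Prop :=
  ∃ χ : H →* ZMod (p ^ 2), (∀ h, ZMod.castHom (dvd_pow_self p two_ne_zero) (ZMod p) (χ h) = 1) ∧
    (∃ U : Subgroup G, IsOpen (U : Set G) ∧ ∀ h : H, (h : G) ∈ U → χ h = 1) ∧
    ∀ b : H → ZMod p, (∀ h h', b (h * h') = b h + b h') →
      (∃ U : Subgroup G, IsOpen (U : Set G) ∧ ∀ h : H, (h : G) ∈ U → b h = 0) →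
      ∃ c : H → ZMod (p ^ 2), (∀ h h', c (h * h') = c h + χ h * c h') ∧
        (∃ U : Subgroup G, IsOpen (U : Set G) ∧ ∀ h : H, (h : G) ∈ U → c h = 0) ∧
        ∀ h, ZMod.castHom (dvd_pow_self p two_ne_zero) (ZMod p) (c h) = b h

section CharP

variable {F K : Type*} [Field F] [Field K] [Algebra F K] [IsGalois F K]
  (p : ℕ) [Fact p.Prime] [CharP K p]

open WittVector

theorem sq_dvd_of_intCast_mem_ker_truncate {n : ℤ}
    (hn : (n : WittVector p K) ∈ RingHom.ker (truncate (p := p) (R := K) 2)) :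
    (p ^ 2 : ℤ) ∣ n := by
  rw [mem_ker_truncate] at hn
  have hcoeff (m : ℤ) : (m : WittVector p K).coeff 0 = m :=
    map_intCast (constantCoeff (p := p) (R := K)) m
  obtain ⟨m, rfl⟩ := (CharP.intCast_eq_zero_iff K p n).mp (hcoeff n ▸ hn 0 two_pos)
  have h1 := hn 1 one_lt_two
  rw [Int.cast_mul, mul_comm, Int.cast_natCast, mul_charP_coeff_succ, hcoeff] at h1
  obtain ⟨l, rfl⟩ := (CharP.intCast_eq_zero_iff K p m).mp
    (pow_eq_zero_iff (Fact.out : p.Prime).ne_zero |>.mp h1)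
  exact ⟨l, by ring⟩

theorem exists_natCast_eq_of_pow_char_eq {x : K} (hx : x ^ p = x) : ∃ n : ℕ, (n : K) = x := by
  let _ := ZMod.algebra K p
  have hmem := (Subfield.mem_bot_iff_pow_eq_self K p).mpr hx
  rw [Subfield.bot_eq_of_zMod_algebra p] at hmem
  obtain ⟨z, hz⟩ := hmem
  exact ⟨z.val, by rw [← hz, ← map_natCast (algebraMap (ZMod p) K), ZMod.natCast_zmod_val]⟩

theorem exists_eq_verschiebung {R : Type*} [CommRing R] {x : WittVector p R}
    (hx : x.coeff 0 = 0) : ∃ y, x = verschiebung y :=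
  ⟨x.shift 1, by
    rw [verschiebung_shift x 0 (by simpa using hx)]
    ext i
    simp [shift_coeff]⟩

theorem verschiebung_mem_ker_truncate_iff {R : Type*} [CommRing R] {x : WittVector p R} :
    verschiebung x ∈ RingHom.ker (truncate (p := p) (R := R) 2) ↔ x.coeff 0 = 0 := by
  rw [mem_ker_truncate]
  refine ⟨fun h ↦ by simpa using h 1 one_lt_two, fun h i hi ↦ ?_⟩
  interval_cases i
  · exact verschiebung_coeff_zero x
  · rw [verschiebung_coeff_succ, h]

theorem exists_witt_artinSchreier [IsSepClosed K] (x : K) :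
    ∃ y : K, frobenius (teichmuller p x + verschiebung (teichmuller p y)) -
      (teichmuller p x + verschiebung (teichmuller p y)) - teichmuller p (x ^ p - x) ∈
        RingHom.ker (truncate (p := p) (R := K) 2) := by
  have hfrob (z : K) : frobenius (teichmuller p z) = teichmuller p (z ^ p) := by
    rw [frobenius_eq_map_frobenius, map_teichmuller, _root_.frobenius_def]
  obtain ⟨D, hD⟩ : ∃ D, teichmuller p (x ^ p) - teichmuller p x - teichmuller p (x ^ p - x) =
      verschiebung D := by
    apply exists_eq_verschiebung
    rw [← constantCoeff_apply, map_sub, map_sub]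
    simp only [constantCoeff_apply, teichmuller_coeff_zero, sub_self]
  obtain ⟨y, hy⟩ := IsSepClosed.exists_root_C_mul_X_pow_add_C_mul_X_add_C (n := p) 1 (-1)
    (D.coeff 0) (CharP.cast_eq_zero K p) (Fact.out : p.Prime).two_le (neg_ne_zero.mpr one_ne_zero)
  refine ⟨y, ?_⟩
  have : frobenius (teichmuller p x + verschiebung (teichmuller p y)) -
      (teichmuller p x + verschiebung (teichmuller p y)) - teichmuller p (x ^ p - x) =
      verschiebung (D + teichmuller p (y ^ p) - teichmuller p y) := by
    rw [map_add, hfrob, frobenius_verschiebung, ← verschiebung_frobenius, hfrob,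
      AddMonoidHom.map_sub, AddMonoidHom.map_add, ← hD]
    ring
  rw [this, verschiebung_mem_ker_truncate_iff]
  rw [← constantCoeff_apply]
  rw [map_sub, map_add]
  simp only [constantCoeff_apply, teichmuller_coeff_zero]
  linear_combination hy

theorem hasCyclotomicLifts_of_charP [IsSepClosed K] (H : Subgroup Gal(K/F)) :
    HasCyclotomicLifts p H := by
  refine ⟨1, fun h ↦ map_one _, ⟨⊤, isOpen_univ, fun _ _ ↦ rfl⟩, fun b hb ⟨N, hN, hbN⟩ ↦ ?_⟩
  obtain ⟨x, hx⟩ := exists_smul_eq_add_of_add_cocycle H N hN (fun h ↦ ((b h).cast : K))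
    (fun h h' ↦ by
      have (z : ZMod p) (g : Gal(K/F)) : g (z.cast : K) = z.cast := by
        rw [ZMod.cast_eq_val, map_natCast]
      rw [this, hb, ZMod.cast_add dvd_rfl]) (fun h hh ↦ by rw [hbN h hh, ZMod.cast_zero])
  have hx' (h : H) : (h : Gal(K/F)) (x ^ p - x) = x ^ p - x := by
    rw [map_sub, map_pow, hx, add_pow_char, ← ZMod.cast_pow dvd_rfl, ZMod.pow_card]
    ring
  obtain ⟨y, hy⟩ := exists_witt_artinSchreier p x
  set Y : WittVector p K := teichmuller p x + verschiebung (teichmuller p y) with hY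
  let J : Ideal (WittVector p K) := RingHom.ker (truncate (p := p) (R := K) 2)
  let A (g : Gal(K/F)) : WittVector p K →+* WittVector p K := map (g : K →+* K)
  have hAJ (g : Gal(K/F)) {z : WittVector p K} (hz : z ∈ J) : A g z ∈ J := by
    rw [mem_ker_truncate] at hz ⊢
    intro i hi
    simp [A, map_coeff, hz i hi]
  have hFA (g : Gal(K/F)) (z : WittVector p K) : frobenius (A g z) = A g (frobenius z) := by
    ext i
    simp [A, map_coeff, coeff_frobenius_charP]
  have key (h : H) : ∃ n : ℕ, A h Y - Y - n ∈ J ∧ (n : ZMod p) = b h := by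
    have h0 : (A h Y - Y - ((b h).val : WittVector p K)).coeff 0 = 0 := by
      rw [← constantCoeff_apply]
      rw [map_sub, map_sub, map_natCast, ← ZMod.cast_eq_val]
      have hY0 : Y.coeff 0 = x := by
        rw [← constantCoeff_apply]
        rw [hY, map_add]
        simp [constantCoeff_apply]
      simp only [constantCoeff_apply, A, map_coeff, hY0]
      change (h : Gal(K/F)) x - x - _ = 0
      rw [hx]
      ring
    obtain ⟨C, hC⟩ := exists_eq_verschiebung p h0
    have hFC : verschiebung (frobenius C - C) ∈ J := by
      have e1 : verschiebung (frobenius C - C) =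
          A h (frobenius Y - Y - teichmuller p (x ^ p - x)) -
            (frobenius Y - Y - teichmuller p (x ^ p - x)) := by
        have e2 : A h (teichmuller p (x ^ p - x)) = teichmuller p (x ^ p - x) := by
          simp only [A, map_teichmuller]
          exact congrArg _ (hx' h)
        rw [map_sub, verschiebung_frobenius, ← frobenius_verschiebung, ← hC]
        simp only [map_sub, map_natCast, hFA, e2]
        ring
      rw [e1]
      exact J.sub_mem (hAJ _ hy) hy
    rw [verschiebung_mem_ker_truncate_iff] at hFC
    have hC0 : C.coeff 0 ^ p = C.coeff 0 := by
      rw [← constantCoeff_apply, map_sub] at hFC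
      simpa [constantCoeff_apply, coeff_frobenius_charP, sub_eq_zero] using hFC
    obtain ⟨n, hn⟩ := exists_natCast_eq_of_pow_char_eq p hC0
    refine ⟨(b h).val + n * p, ?_, by simp⟩
    have e3 : A h Y - Y - (((b h).val + n * p : ℕ) : WittVector p K) =
        verschiebung (C - (n : WittVector p K)) := by
      rw [map_sub, ← hC, ← map_natCast (WittVector.frobenius (p := p) (R := K)) n,
        verschiebung_frobenius]
      push_cast
      ring
    rw [e3, verschiebung_mem_ker_truncate_iff]
    rw [← constantCoeff_apply]
    rw [map_sub, map_natCast, hn, constantCoeff_apply, sub_self]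
  choose n hn hnb using key
  refine ⟨fun h ↦ n h, fun h h' ↦ ?_, ⟨MulAction.stabilizer _ x ⊓ MulAction.stabilizer _ y,
    (stabilizer_isOpen_of_isIntegral x).inter (stabilizer_isOpen_of_isIntegral y),
      fun h hh ↦ ?_⟩, fun h ↦ by rw [map_natCast, hnb]⟩
  · have hmem : (((n (h * h') - n h - n h' : ℤ)) : WittVector p K) ∈ J := by
      have hmul : A (h * h' : H) Y = A h (A h' Y) := by
        ext i
        simp [A, map_coeff]
      have e4 : (((n (h * h') - n h - n h' : ℤ)) : WittVector p K) =
          (A h Y - Y - n h) + A h (A h' Y - Y - n h') - (A (h * h' : H) Y - Y - n (h * h')) := by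
        simp only [map_sub, map_natCast, hmul]
        push_cast
        ring
      rw [e4]
      exact J.sub_mem (J.add_mem (hn h) (hAJ _ (hn h'))) (hn _)
    have := sq_dvd_of_intCast_mem_ker_truncate p hmem
    rw [← Nat.cast_pow, ← ZMod.intCast_zmod_eq_zero_iff_dvd] at this
    push_cast at this
    simp only [MonoidHom.one_apply, one_mul]
    linear_combination this
  · have hAY : A h Y = Y := by
      have hhx : (h : Gal(K/F)) x = x := hh.1
      have hhy : (h : Gal(K/F)) y = y := hh.2
      simp only [A, hY, map_add, map_verschiebung, map_teichmuller]
      change teichmuller p ((h : Gal(K/F)) x) + verschiebung (teichmuller p ((h : Gal(K/F)) y)) = _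
      rw [hhx, hhy]
    have hmem : ((-(n h) : ℤ) : WittVector p K) ∈ J := by
      have := hn h
      rw [hAY, sub_self, zero_sub] at this
      simpa using this
    have := sq_dvd_of_intCast_mem_ker_truncate p hmem
    rw [← Nat.cast_pow, ← ZMod.intCast_zmod_eq_zero_iff_dvd] at this
    simpa using this

end CharP

section Kummer

theorem pow_zmod_val_add {M : Type*} [Monoid M] {n : ℕ} [NeZero n] {z : M} (hz : z ^ n = 1)
    (x y : ZMod n) : z ^ (x + y).val = z ^ x.val * z ^ y.val := by
  rw [ZMod.val_add, ← pow_eq_pow_mod _ hz, pow_add]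

theorem pow_zmod_val_mul {M : Type*} [Monoid M] {n : ℕ} {z : M} (hz : z ^ n = 1)
    (x y : ZMod n) : z ^ (x * y).val = (z ^ x.val) ^ y.val := by
  rw [ZMod.val_mul, ← pow_eq_pow_mod _ hz, pow_mul]

variable {F K : Type*} [Field F] [Field K] [Algebra F K] [IsGalois F K]
  (p : ℕ) [Fact p.Prime]

theorem hasCyclotomicLifts_of_isPrimitiveRoot [IsSepClosed K] {η : K}
    (hη : IsPrimitiveRoot η (p ^ 2)) (hpK : (p : K) ≠ 0) (H : Subgroup Gal(K/F))
    (hH : ∀ h : H, ∃ n : ℕ, ((h ^ p ^ n : H) : Gal(K/F)) ∈ MulAction.stabilizer Gal(K/F) η) :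
    HasCyclotomicLifts p H := by
  have hp : p.Prime := Fact.out
  have : NeZero (p ^ 2) := ⟨pow_ne_zero _ hp.ne_zero⟩
  have : NeZero (p : K) := ⟨hpK⟩
  have hη1 := hη.pow_eq_one
  have hη0 : η ≠ 0 := hη.ne_zero (NeZero.ne _)
  have hinj {x y : ZMod (p ^ 2)} (h : η ^ x.val = η ^ y.val) : x = y :=
    ZMod.val_injective _ (hη.pow_inj (ZMod.val_lt x) (ZMod.val_lt y) h)
  have hsurj {w : K} (hw : w ^ (p ^ 2) = 1) : ∃ x : ZMod (p ^ 2), w = η ^ x.val := by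
    obtain ⟨i, hi, rfl⟩ := hη.eq_pow_of_pow_eq_one hw
    exact ⟨i, by rw [ZMod.val_natCast_of_lt hi]⟩
  have hζ1 : (η ^ p) ^ p = 1 := by rw [← pow_mul, ← sq, hη1]
  have hχ_ex (h : H) : ∃ x : ZMod (p ^ 2), (h : Gal(K/F)) η = η ^ x.val :=
    hsurj (by rw [← map_pow, hη1, map_one])
  choose χ' hχ' using hχ_ex
  have hval1 : (1 : ZMod (p ^ 2)).val = 1 :=
    ZMod.val_one'' (one_lt_pow₀ hp.one_lt two_ne_zero).ne'
  have hχ_one {h : H} (hh : (h : Gal(K/F)) η = η) : χ' h = 1 :=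
    hinj (by rw [← hχ', hh, hval1, pow_one])
  let χ : H →* ZMod (p ^ 2) :=
    { toFun := χ'
      map_one' := hχ_one rfl
      map_mul' := fun h h' ↦ hinj (by
        rw [← hχ', mul_comm, pow_zmod_val_mul hη1, Subgroup.coe_mul, AlgEquiv.mul_apply, hχ',
          map_pow, hχ', ← pow_mul, ← pow_mul, mul_comm]) }
  let red : ZMod (p ^ 2) →+* ZMod p := ZMod.castHom (dvd_pow_self p two_ne_zero) (ZMod p)
  have hχ_red (h : H) : red (χ h) = 1 := by
    obtain ⟨n, hn⟩ := hH h
    rw [← ZMod.pow_card_pow (n := n) (red (χ h)), ← map_pow, ← map_pow]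
    exact (congrArg red (hχ_one hn)).trans (map_one red)
  have hpow_iff {a b : ℕ} : η ^ (p * a) = η ^ (p * b) ↔ (a : ZMod p) = b := by
    rw [(hη.isOfFinOrder (NeZero.ne _)).pow_eq_pow_iff_modEq, ← hη.eq_orderOf, sq,
      Nat.ModEq.mul_left_cancel_iff' hp.ne_zero, ZMod.natCast_eq_natCast_iff]
  have hpow_red {x : ZMod (p ^ 2)} {y : ZMod p} :
      η ^ (p * x.val) = η ^ (p * y.val) ↔ red x = y := by
    rw [hpow_iff, ZMod.natCast_zmod_val, ZMod.castHom_apply, ZMod.cast_eq_val]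
  have hζ_fixed (h : H) : (h : Gal(K/F)) (η ^ p) = η ^ p := by
    have := (hpow_red (x := χ h) (y := 1)).mpr (hχ_red h)
    rw [ZMod.val_one, mul_one, mul_comm, pow_mul] at this
    rw [map_pow, hχ', ← this]
    rfl
  refine ⟨χ, hχ_red, ⟨_, stabilizer_isOpen_of_isIntegral η, fun h hh ↦ hχ_one hh⟩,
    fun b hb ⟨N, hN, hbN⟩ ↦ ?_⟩
  obtain ⟨x, hx0, hx⟩ := exists_smul_eq_mul_of_mul_cocycle H N hN (fun h ↦ (η ^ p) ^ (b h).val)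
    (fun h ↦ pow_ne_zero _ (pow_ne_zero _ hη0))
    (fun h h' ↦ by rw [map_pow, hζ_fixed, hb, pow_zmod_val_add hζ1])
    (fun h hh ↦ by rw [hbN h hh, ZMod.val_zero, pow_zero])
  obtain ⟨y, rfl⟩ := IsSepClosed.exists_pow_nat_eq x p
  have hy0 : y ≠ 0 := fun h ↦ hx0 (by rw [h, zero_pow hp.ne_zero])
  have hc_ex (h : H) : ∃ z : ZMod (p ^ 2), (h : Gal(K/F)) y / y = η ^ z.val := by
    apply hsurj
    rw [sq, pow_mul, div_pow, ← map_pow, hx, mul_div_cancel_right₀ _ hx0, ← pow_mul, mul_comm,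
      pow_mul, hζ1, one_pow]
  choose c hc using hc_ex
  have hc' (h : H) : (h : Gal(K/F)) y = η ^ (c h).val * y := by rw [← hc, div_mul_cancel₀ _ hy0]
  refine ⟨c, fun h h' ↦ hinj ?_, ⟨_, stabilizer_isOpen_of_isIntegral y, fun h hh ↦ hinj ?_⟩,
    fun h ↦ hpow_red.mp ?_⟩
  · apply mul_right_cancel₀ hy0
    rw [← hc', pow_zmod_val_add hη1, pow_zmod_val_mul hη1, Subgroup.coe_mul, AlgEquiv.mul_apply,
      hc', map_mul, hc', map_pow, hχ']
    change (η ^ (χ h).val) ^ _ * _ = _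
    ring
  · rw [← hc, show (h : Gal(K/F)) y = y from hh, div_self hy0, ZMod.val_zero, pow_zero]
  · apply mul_right_cancel₀ hx0
    rw [pow_mul, pow_mul, ← hx, map_pow, hc', mul_pow, ← pow_mul, ← pow_mul, mul_comm p]

end Kummer

theorem exists_isOpen_forall_hasCyclotomicLifts {F K : Type*} [Field F] [Field K] [Algebra F K]
    [IsGalois F K] [IsSepClosed K] (p : ℕ) [Fact p.Prime] :
    ∃ U : Subgroup Gal(K/F), IsOpen (U : Set Gal(K/F)) ∧ ∀ H : Subgroup Gal(K/F),
      (∀ h : H, ∃ n : ℕ, ((h ^ p ^ n : H) : Gal(K/F)) ∈ U) → HasCyclotomicLifts p H := by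
  by_cases hpK : (p : K) = 0
  · have : CharP K p := (CharP.charP_iff_prime_eq_zero Fact.out).mpr hpK
    exact ⟨⊤, isOpen_univ, fun H _ ↦ hasCyclotomicLifts_of_charP p H⟩
  · have : NeZero ((p ^ 2 : ℕ) : K) := ⟨by rw [Nat.cast_pow]; exact pow_ne_zero _ hpK⟩
    obtain ⟨η, hη⟩ := HasEnoughRootsOfUnity.exists_primitiveRoot K (p ^ 2)
    exact ⟨_, stabilizer_isOpen_of_isIntegral η,
      fun H hH ↦ hasCyclotomicLifts_of_isPrimitiveRoot p hη hpK H hH⟩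

theorem IsPGroup.exists_ne_zero_forall_smul_eq {p : ℕ} [Fact p.Prime] {Γ V : Type*} [Group Γ]
    [Finite Γ] (hΓ : IsPGroup p Γ) [AddCommGroup V] [Module (ZMod p) V] [Nontrivial V]
    [DistribMulAction Γ V] : ∃ v : V, v ≠ 0 ∧ ∀ g : Γ, g • v = v := by
  obtain ⟨v, hv⟩ := exists_ne (0 : V)
  let W : Submodule (ZMod p) V := Submodule.span (ZMod p) (Set.range fun g : Γ ↦ g • v)
  have hfin : Module.Finite (ZMod p) W := Module.Finite.span_of_finite _ (Set.finite_range _)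
  have : Finite W := Module.finite_of_finite (ZMod p)
  have hW (g : Γ) {w : V} (hw : w ∈ W) : g • w ∈ W := by
    induction hw using Submodule.span_induction with
    | mem x hx =>
      obtain ⟨g', rfl⟩ := hx
      exact Submodule.subset_span ⟨g * g', mul_smul _ _ _⟩
    | zero => rw [smul_zero]; exact W.zero_mem
    | add x y _ _ hx hy => rw [smul_add]; exact W.add_mem hx hy
    | smul a x _ hx =>
      have := ZMod.map_smul (DistribSMul.toAddMonoidHom V g) a x
      simp only [DistribSMul.toAddMonoidHom_apply] at this
      rw [this]
      exact W.smul_mem a hx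
  let _ : MulAction Γ W :=
    { smul := fun g w ↦ ⟨g • (w : V), hW g w.2⟩
      one_smul := fun w ↦ Subtype.ext (one_smul Γ (w : V))
      mul_smul := fun g g' w ↦ Subtype.ext (mul_smul g g' (w : V)) }
  have hvW : v ∈ W := Submodule.subset_span ⟨1, one_smul Γ v⟩
  have hcard : p ∣ Nat.card W := by
    have hord : addOrderOf (⟨v, hvW⟩ : W) = p := addOrderOf_eq_prime
      (by rw [← Nat.cast_smul_eq_nsmul (ZMod p), CharP.cast_eq_zero, zero_smul])
      (fun h ↦ hv (congrArg Subtype.val h))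
    exact (dvd_of_eq hord.symm).trans (addOrderOf_dvd_natCard _)
  have h0 : (0 : W) ∈ MulAction.fixedPoints Γ W := fun g ↦ Subtype.ext (smul_zero g)
  obtain ⟨w, hw, hne⟩ := hΓ.exists_fixed_point_of_prime_dvd_card_of_fixed_point W hcard h0
  exact ⟨w, fun h ↦ hne (Subtype.ext h.symm), fun g ↦ congrArg Subtype.val (hw g)⟩

section GeneralLinearGroup

open Matrix

variable {p : ℕ} [Fact p.Prime] {k : Type*} [Field k] [CharP k p]

theorem exists_GL_mulVec_eq {v : Fin 2 → k} (hv : v ≠ 0) :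
    ∃ P : GL (Fin 2) k, P.1 *ᵥ ![1, 0] = v := by
  by_cases h0 : v 0 = 0
  · have h1 : v 1 ≠ 0 := fun h1 ↦ hv (by ext i; fin_cases i <;> assumption)
    refine ⟨GeneralLinearGroup.mkOfDetNeZero !![v 0, 1; v 1, 0] (by simpa [det_fin_two] using h1),
      ?_⟩
    ext i
    fin_cases i <;> simp [GeneralLinearGroup.mkOfDetNeZero, mulVec, dotProduct, Fin.sum_univ_two]
  · refine ⟨GeneralLinearGroup.mkOfDetNeZero !![v 0, 0; v 1, 1] (by simpa [det_fin_two] using h0),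
      ?_⟩
    ext i
    fin_cases i <;> simp [GeneralLinearGroup.mkOfDetNeZero, mulVec, dotProduct, Fin.sum_univ_two]

/-- A representation on `k²` with finite `p`-group image is conjugate to a unipotent one. -/
theorem exists_conj_unipotent {H : Type*} [Group H] (ρ : H →* GL (Fin 2) k)
    [Finite ρ.range] (hρ : ∀ h, ∃ n : ℕ, ρ h ^ p ^ n = 1) :
    ∃ (P : GL (Fin 2) k) (b : H → k), ∀ h, (P⁻¹ * ρ h * P).1 = !![1, b h; 0, 1] := by
  let _ := ZMod.algebra k p
  let _ : DistribMulAction ρ.range (Fin 2 → k) :=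
    { smul := fun g v ↦ g.1.1 *ᵥ v
      one_smul := fun v ↦ one_mulVec v
      mul_smul := fun g g' v ↦ (mulVec_mulVec v g.1.1 g'.1.1).symm
      smul_zero := fun g ↦ mulVec_zero _
      smul_add := fun g ↦ mulVec_add _ }
  have hpg : IsPGroup p ρ.range := by
    rintro ⟨_, h, rfl⟩
    obtain ⟨n, hn⟩ := hρ h
    exact ⟨n, Subtype.ext hn⟩
  obtain ⟨v, hv, hfix⟩ := hpg.exists_ne_zero_forall_smul_eq (V := Fin 2 → k)
  obtain ⟨P, hP⟩ := exists_GL_mulVec_eq hv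
  let N : H →* GL (Fin 2) k := (MulAut.conj P⁻¹).toMonoidHom.comp ρ
  have hN (h : H) : N h = P⁻¹ * ρ h * P := by simp [N]
  have hcol (h : H) : (N h).1 *ᵥ ![1, 0] = ![1, 0] := by
    have h1 : (ρ h).1 *ᵥ v = v := hfix ⟨_, h, rfl⟩
    rw [hN, Units.val_mul, Units.val_mul, ← mulVec_mulVec, hP, ← mulVec_mulVec, h1, ← hP,
      mulVec_mulVec, ← Units.val_mul, inv_mul_cancel, Units.val_one, one_mulVec]
  have h00 (h : H) : (N h).1 0 0 = 1 := by
    simpa [mulVec, dotProduct, Fin.sum_univ_two] using congr_fun (hcol h) 0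
  have h10 (h : H) : (N h).1 1 0 = 0 := by
    simpa [mulVec, dotProduct, Fin.sum_univ_two] using congr_fun (hcol h) 1
  let d : H →* k :=
    { toFun := fun h ↦ (N h).1 1 1
      map_one' := by simp
      map_mul' := fun h h' ↦ by simp [mul_apply, Fin.sum_univ_two, h10] }
  have h11 (h : H) : (N h).1 1 1 = 1 := by
    obtain ⟨n, hn⟩ := hρ h
    have hd : d h ^ (p ^ n * 1) = 1 := by
      have hNn : N (h ^ p ^ n) = 1 := by rw [hN, map_pow, hn]; group
      rw [mul_one, ← map_pow]
      change (N _).1 1 1 = 1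
      rw [hNn]
      simp
    have : ExpChar k p := .prime Fact.out
    rw [ExpChar.pow_prime_pow_mul_eq_one_iff, pow_one] at hd
    exact hd
  refine ⟨P, fun h ↦ (N h).1 0 1, fun h ↦ ?_⟩
  rw [← hN]
  ext i j
  fin_cases i <;> fin_cases j <;> simp [h00, h10, h11]

variable {R : Type*} [CommRing R] {π : R →+* k}

theorem isLocalHom_of_mul_eq_zero (hπ : Function.Surjective π)
    (hsq : ∀ x y, π x = 0 → π y = 0 → x * y = 0) : IsLocalHom π where
  map_nonunit x hx := by
    obtain ⟨y, hy⟩ := hπ (π x)⁻¹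
    have h0 : π (x * y - 1) = 0 := by
      rw [map_sub, map_mul, hy, mul_inv_cancel₀ hx.ne_zero, map_one, sub_self]
    exact IsUnit.of_mul_eq_one (y * (2 - x * y)) (by linear_combination -hsq _ _ h0 h0)

theorem GL_map_surjective (hπ : Function.Surjective π) [IsLocalHom π] {n : Type*} [Fintype n]
    [DecidableEq n] : Function.Surjective (GeneralLinearGroup.map (n := n) π) := by
  intro A
  choose s hs using hπ
  have hmap : π.mapMatrix (A.1.map s) = A.1 := by
    ext i j
    exact hs _
  have hdet : IsUnit (A.1.map s).det := by
    apply isUnit_of_map_unit π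
    rw [RingHom.map_det, hmap]
    exact (isUnit_iff_isUnit_det _).mp A.isUnit
  refine ⟨((isUnit_iff_isUnit_det _).mpr hdet).unit, ?_⟩
  apply Units.ext
  exact hmap

section kernel

variable {n : Type*} [Fintype n] [DecidableEq n]

theorem map_sub_one_apply_of_mem_ker {A : GL n R}
    (hA : A ∈ (GeneralLinearGroup.map (n := n) π).ker) (i j : n) : π ((A.1 - 1) i j) = 0 := by
  have : π.mapMatrix (A.1 - 1) = 0 := by
    rw [map_sub, map_one, sub_eq_zero]
    exact congrArg Units.val hA
  exact congr_fun (congr_fun this i) j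

theorem sub_one_mul_sub_one_of_mem_ker (hsq : ∀ x y, π x = 0 → π y = 0 → x * y = 0)
    {A B : GL n R} (hA : A ∈ (GeneralLinearGroup.map (n := n) π).ker)
    (hB : B ∈ (GeneralLinearGroup.map (n := n) π).ker) : (A.1 - 1) * (B.1 - 1) = 0 := by
  ext i j
  rw [mul_apply]
  exact Finset.sum_eq_zero fun l _ ↦ hsq _ _ (map_sub_one_apply_of_mem_ker hA i l)
    (map_sub_one_apply_of_mem_ker hB l j)

theorem GL_map_ker_comm (hsq : ∀ x y, π x = 0 → π y = 0 → x * y = 0)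
    (A B : (GeneralLinearGroup.map (n := n) π).ker) : A * B = B * A := by
  apply Subtype.ext
  apply Units.ext
  have h1 := sub_one_mul_sub_one_of_mem_ker hsq A.2 B.2
  have h2 := sub_one_mul_sub_one_of_mem_ker hsq B.2 A.2
  simp only [sub_mul, mul_sub, one_mul, mul_one] at h1 h2
  simp only [Subgroup.coe_mul, Units.val_mul]
  rw [← sub_eq_zero, ← sub_eq_zero.mpr (h1.trans h2.symm)]
  abel

theorem GL_map_ker_pow {p : ℕ} (hsq : ∀ x y, π x = 0 → π y = 0 → x * y = 0)
    (hp : ∀ x, π x = 0 → (p : R) * x = 0)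
    (A : (GeneralLinearGroup.map (n := n) π).ker) : A ^ p = 1 := by
  apply Subtype.ext
  apply Units.ext
  have h1 := sub_one_mul_sub_one_of_mem_ker hsq A.2 A.2
  have hpow (m : ℕ) : (A : GL n R).1 ^ m = 1 + m * ((A : GL n R).1 - 1) := by
    induction m with
    | zero => simp
    | succ m ih =>
      rw [pow_succ, ih, ← sub_eq_zero, ← mul_zero (m : Matrix n n R), ← h1]
      push_cast
      noncomm_ring
  simp only [Subgroup.coe_pow, Units.val_pow_eq_pow_val, hpow, Subgroup.coe_one, Units.val_one,
    add_eq_left]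
  ext i j
  rw [← nsmul_eq_mul, Matrix.smul_apply, nsmul_eq_mul, hp _ (map_sub_one_apply_of_mem_ker A.2 i j)]
  rfl

end kernel

/-- A locally constant homomorphism to `k` with finite image lifts to a twisted cocycle. -/
theorem HasCyclotomicLifts.exists_cocycle_lift {G : Type*} [Group G] [TopologicalSpace G]
    {H : Subgroup G} (hH : HasCyclotomicLifts p H) (hπ : Function.Surjective π)
    (hp2 : (p : R) ^ 2 = 0) :
    ∃ χ : H →* R, (∀ h, π (χ h) = 1) ∧
      (∃ U : Subgroup G, IsOpen (U : Set G) ∧ ∀ h : H, (h : G) ∈ U → χ h = 1) ∧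
      ∀ b : H → k, (∀ h h', b (h * h') = b h + b h') → (Set.range b).Finite →
        (∃ U : Subgroup G, IsOpen (U : Set G) ∧ ∀ h : H, (h : G) ∈ U → b h = 0) →
        ∃ c : H → R, (∀ h h', c (h * h') = c h + χ h * c h') ∧
          (∃ U : Subgroup G, IsOpen (U : Set G) ∧ ∀ h : H, (h : G) ∈ U → c h = 0) ∧
          ∀ h, π (c h) = b h := by
  obtain ⟨χ, hχ, ⟨U, hU, hχU⟩, hlift⟩ := hH
  let _ := ZMod.algebra k p
  let q : ZMod (p ^ 2) →+* R := ZMod.castHom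
    (ringChar.dvd (by rw [Nat.cast_pow, hp2]) : ringChar R ∣ p ^ 2) R
  have hq (z : ZMod (p ^ 2)) : π (q z) =
      algebraMap (ZMod p) k (ZMod.castHom (dvd_pow_self p two_ne_zero) (ZMod p) z) :=
    RingHom.congr_fun (RingHom.ext_zmod (π.comp q) ((algebraMap (ZMod p) k).comp
      (ZMod.castHom (dvd_pow_self p two_ne_zero) (ZMod p)))) z
  refine ⟨(q : ZMod (p ^ 2) →* R).comp χ, fun h ↦ ?_, ⟨U, hU, fun h hh ↦ ?_⟩,
    fun b hb hfin ⟨N, hN, hbN⟩ ↦ ?_⟩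
  · change π (q (χ h)) = 1
    rw [hq, hχ, map_one]
  · change q (χ h) = 1
    rw [hχU h hh, map_one]
  let V : Submodule (ZMod p) k := Submodule.span (ZMod p) (Set.range b)
  have : Module.Finite (ZMod p) V := Module.Finite.span_of_finite _ hfin
  let B := Module.finBasis (ZMod p) V
  let b' (h : H) : V := ⟨b h, Submodule.subset_span ⟨h, rfl⟩⟩
  have hb' (h h' : H) : b' (h * h') = b' h + b' h' := Subtype.ext (hb h h')
  choose c hc hcU hcred using fun i ↦ hlift (fun h ↦ B.repr (b' h) i)
    (fun h h' ↦ by rw [hb', map_add, Finsupp.add_apply])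
    ⟨N, hN, fun h hh ↦ by
      have : b' h = 0 := Subtype.ext (hbN h hh)
      rw [this, map_zero, Finsupp.zero_apply]⟩
  choose U' hU' hcU' using hcU
  choose e he using fun i ↦ hπ (B i : k)
  refine ⟨fun h ↦ ∑ i, q (c i h) * e i, fun h h' ↦ ?_, ⟨⨅ i, U' i, ?_, fun h hh ↦ ?_⟩, fun h ↦ ?_⟩
  · rw [Finset.mul_sum, ← Finset.sum_add_distrib]
    refine Finset.sum_congr rfl fun i _ ↦ ?_
    rw [hc, map_add, map_mul]
    change _ = _ + q (χ h) * _
    ring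
  · rw [Subgroup.coe_iInf]
    exact isOpen_iInter_of_finite hU'
  · refine Finset.sum_eq_zero fun i _ ↦ ?_
    rw [hcU' i h (Subgroup.mem_iInf.mp hh i), map_zero, zero_mul]
  · have := congrArg Subtype.val (B.sum_repr (b' h))
    rw [map_sum]
    refine Eq.trans (Finset.sum_congr rfl fun i _ ↦ ?_) ((V.coe_sum _ _).symm.trans this)
    rw [map_mul, hq, hcred, he, Submodule.coe_smul, Algebra.smul_def]

theorem HasCyclotomicLifts.exists_GL_lift {G : Type*} [Group G] [TopologicalSpace G]
    [ContinuousMul G] [CompactSpace G]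
    {H : Subgroup G} (hH : HasCyclotomicLifts p H) (hπ : Function.Surjective π)
    (hsq : ∀ x y, π x = 0 → π y = 0 → x * y = 0) (hp2 : (p : R) ^ 2 = 0)
    (ρ : G →* GL (Fin 2) k) (hρ : IsOpen (ρ.ker : Set G))
    (hρH : ∀ h : H, ∃ n : ℕ, ρ h ^ p ^ n = 1) :
    ∃ τ : H →* GL (Fin 2) R, (∀ h, GeneralLinearGroup.map π (τ h) = ρ h) ∧
      ∃ U : Subgroup G, IsOpen (U : Set G) ∧ ∀ h : H, (h : G) ∈ U → τ h = 1 := by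
  have : Finite (G ⧸ ρ.ker) := ρ.ker.quotient_finite_of_isOpen hρ
  have : Finite ρ.range := Finite.of_equiv _ (QuotientGroup.quotientKerEquivRange ρ).toEquiv
  have hrange : (ρ.comp H.subtype).range ≤ ρ.range := by
    rintro _ ⟨h, rfl⟩
    exact ⟨h, rfl⟩
  have : Finite (ρ.comp H.subtype).range :=
    Finite.of_injective _ (Subgroup.inclusion_injective hrange)
  obtain ⟨P, b, hb⟩ := exists_conj_unipotent (p := p) (ρ.comp H.subtype) hρH
  obtain ⟨χ, hχ, ⟨U, hU, hχU⟩, hlift⟩ := hH.exists_cocycle_lift hπ hp2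
  have hbρ (h : H) : b h = (P⁻¹ * ρ h * P).1 0 1 := by
    have := congr_fun (congr_fun (hb h) 0) 1
    simpa using this.symm
  obtain ⟨c, hc, ⟨N, hN, hcN⟩, hcb⟩ := hlift b
    (fun h h' ↦ by
      have h1 : P⁻¹ * ρ (h * h') * P = (P⁻¹ * ρ h * P) * (P⁻¹ * ρ h' * P) := by
        rw [map_mul]
        group
      have h2 : (P⁻¹ * (ρ.comp H.subtype) (h * h') * P).1 0 1 =
          ((P⁻¹ * (ρ.comp H.subtype) h * P).1 * (P⁻¹ * (ρ.comp H.subtype) h' * P).1) 0 1 :=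
        congrArg (fun A : GL (Fin 2) k ↦ A.1 0 1) h1
      rw [hb, hb, hb] at h2
      simpa [mul_apply, Fin.sum_univ_two, add_comm] using h2)
    ((Set.toFinite (Set.range fun g : ρ.range ↦ (P⁻¹ * g.1 * P).1 0 1)).subset (by
      rintro _ ⟨h, rfl⟩
      exact ⟨⟨ρ h, h, rfl⟩, (hbρ h).symm⟩))
    ⟨ρ.ker, hρ, fun h hh ↦ by
      rw [hbρ, MonoidHom.mem_ker.mp hh, mul_one, inv_mul_cancel]
      simp⟩
  have : IsLocalHom π := isLocalHom_of_mul_eq_zero hπ hsq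
  obtain ⟨P', rfl⟩ := GL_map_surjective (n := Fin 2) hπ P
  let M : H →* Matrix (Fin 2) (Fin 2) R :=
    { toFun := fun h ↦ !![χ h, c h; 0, 1]
      map_one' := by
        have hc1 : c 1 = 0 := by simpa using hc 1 1
        rw [map_one, hc1, one_fin_two]
      map_mul' := fun h h' ↦ by
        rw [map_mul, hc, mul_fin_two]
        congr 1
        simp [add_comm] }
  refine ⟨(MulAut.conj P').toMonoidHom.comp M.toHomUnits, fun h ↦ ?_,
    ⟨U ⊓ N, hU.inter hN, fun h hh ↦ ?_⟩⟩
  · have hM : GeneralLinearGroup.map π (M.toHomUnits h) =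
        (GeneralLinearGroup.map π P')⁻¹ * ρ h * GeneralLinearGroup.map π P' := by
      apply Units.ext
      refine Eq.trans ?_ (hb h).symm
      ext i j
      change π (M h i j) = _
      fin_cases i <;> fin_cases j <;> simp [M, hχ, hcb]
    change GeneralLinearGroup.map π (P' * M.toHomUnits h * P'⁻¹) = _
    rw [map_mul, map_mul, hM, map_inv]
    group
  · have hM : M.toHomUnits h = 1 := by
      apply Units.ext
      change !![χ h, c h; 0, 1] = 1
      rw [hχU h hh.1, hcN h hh.2, one_fin_two]
    change P' * M.toHomUnits h * P'⁻¹ = 1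
    rw [hM, mul_one, mul_inv_cancel]

end GeneralLinearGroup

theorem exists_isOpen_subgroup_not_dvd_index {G : Type*} [Group G] [TopologicalSpace G]
    [IsTopologicalGroup G] [CompactSpace G] [TotallyDisconnectedSpace G] (p : ℕ) [Fact p.Prime]
    (U : Subgroup G) (hU : IsOpen (U : Set G)) :
    ∃ H : Subgroup G, IsOpen (H : Set G) ∧ ¬ p ∣ H.index ∧
      ∀ h ∈ H, ∃ n : ℕ, h ^ p ^ n ∈ U := by
  obtain ⟨N, hN⟩ := ProfiniteGrp.exist_openNormalSubgroup_sub_open_nhds_of_one hU (one_mem U)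
  have : N.toSubgroup.Normal := N.isNormal'
  have : Finite (G ⧸ N.toSubgroup) := N.toSubgroup.quotient_finite_of_isOpen N.isOpen
  let P : Sylow p (G ⧸ N.toSubgroup) := default
  refine ⟨P.1.comap (QuotientGroup.mk' _), ?_, ?_, fun h hh ↦ ?_⟩
  · refine Subgroup.isOpen_mono (H₁ := N.toSubgroup) (fun n hn ↦ ?_) N.isOpen
    rw [Subgroup.mem_comap, QuotientGroup.mk'_apply, (QuotientGroup.eq_one_iff n).mpr hn]
    exact one_mem _
  · rw [Subgroup.index_comap_of_surjective _ (QuotientGroup.mk'_surjective _)]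
    exact P.not_dvd_index
  · obtain ⟨n, hn⟩ := P.2 ⟨_, hh⟩
    refine ⟨n, hN ?_⟩
    have := congrArg Subtype.val hn
    rw [Subgroup.coe_pow, ← map_pow] at this
    exact (QuotientGroup.eq_one_iff _).mp this

section TruncatedWittVector

variable {p : ℕ} [Fact p.Prime] {k : Type} [CommRing k]

open WittVector

theorem wittRed_truncate (x : WittVector p k) : wittRed p k (truncate 2 x) = x.coeff 0 :=
  RingHom.liftOfRightInverse_comp_apply _ _ _ _ x

theorem wittRed_surjective : Function.Surjective (wittRed p k) := fun x ↦
  ⟨truncate 2 (teichmuller p x), by rw [wittRed_truncate, teichmuller_coeff_zero]⟩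

theorem exists_truncate_verschiebung_eq {x : TruncatedWittVector p 2 k} (hx : wittRed p k x = 0) :
    ∃ y : WittVector p k, truncate 2 (verschiebung y) = x := by
  obtain ⟨x, rfl⟩ := truncate_surjective p 2 k x
  rw [wittRed_truncate] at hx
  obtain ⟨y, rfl⟩ := exists_eq_verschiebung p hx
  exact ⟨y, rfl⟩

variable [CharP k p]

theorem natCast_mul_eq_zero_of_wittRed_eq_zero {x : TruncatedWittVector p 2 k}
    (hx : wittRed p k x = 0) : (p : TruncatedWittVector p 2 k) * x = 0 := by
  obtain ⟨x, rfl⟩ := exists_truncate_verschiebung_eq hx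
  have h : verschiebung x * (p : WittVector p k) =
      verschiebung (x * (p : WittVector p k)) := by
    rw [← verschiebung_mul_frobenius, map_natCast]
  rw [← map_natCast (truncate 2 : WittVector p k →+* _), ← map_mul, mul_comm, h,
    ← RingHom.mem_ker, verschiebung_mem_ker_truncate_iff, mul_charP_coeff_zero]

theorem mul_eq_zero_of_wittRed_eq_zero (x y : TruncatedWittVector p 2 k)
    (hx : wittRed p k x = 0) (hy : wittRed p k y = 0) : x * y = 0 := by
  obtain ⟨x, rfl⟩ := exists_truncate_verschiebung_eq hx
  obtain ⟨y, rfl⟩ := exists_truncate_verschiebung_eq hy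
  rw [← map_mul, ← RingHom.mem_ker, ← verschiebung_mul_frobenius, frobenius_verschiebung,
    verschiebung_mem_ker_truncate_iff, ← mul_assoc, mul_charP_coeff_zero]

end TruncatedWittVector

theorem stmt_0 (p : ℕ) [Fact p.Prime] (k : Type) [Field k] [CharP k p]
    (F : Type) [Field F]
    (ρ : AbsGal F →* GL (Fin 2) k) (hρ : IsOpen (ρ.ker : Set (AbsGal F))) :
    ∃ ρ₂ : AbsGal F →* GL (Fin 2) (TruncatedWittVector p 2 k),
      IsOpen (ρ₂.ker : Set (AbsGal F)) ∧
      (Matrix.GeneralLinearGroup.map (wittRed p k)).comp ρ₂ = ρ := by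
  have hsq := mul_eq_zero_of_wittRed_eq_zero (p := p) (k := k)
  have : IsLocalHom (wittRed p k) := isLocalHom_of_mul_eq_zero wittRed_surjective hsq
  obtain ⟨U, hU, hlift⟩ := exists_isOpen_forall_hasCyclotomicLifts (F := F)
    (K := SeparableClosure F) p
  obtain ⟨H, hH, hindex, hpow⟩ := exists_isOpen_subgroup_not_dvd_index p (ρ.ker ⊓ U)
    (hρ.inter hU)
  have hcyc := hlift H fun h ↦ (hpow h h.2).imp fun n hn ↦ hn.2
  obtain ⟨τ, hτ, N, hN, hτN⟩ := hcyc.exists_GL_lift wittRed_surjective hsq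
    (by rw [sq, natCast_mul_eq_zero_of_wittRed_eq_zero (by rw [map_natCast, CharP.cast_eq_zero])])
    ρ hρ (fun h ↦ (hpow h h.2).imp fun n hn ↦ by rw [← map_pow]; exact hn.1)
  exact exists_lift_of_lift_subgroup _ (GL_map_surjective wittRed_surjective)
    (Fact.out : p.Prime) (GL_map_ker_comm hsq)
    (GL_map_ker_pow hsq fun x ↦ natCast_mul_eq_zero_of_wittRed_eq_zero)
    ρ hρ H hH hindex τ hτ N hN hτN
end

section
/- Let F be a field of characteristic different from 2 containing a primitive 4th root of unity. Then every continuous homomorphism Gal(F_s/F) → U_3(ℤ/2) admits a lift to a continuous homomorphism Gal(F_s/F) → U_3(ℤ/4) along the reduction ℤ/4 → ℤ/2. -/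
open scoped MatrixGroups

/-- A matrix in `GL_d(R)` is upper triangular (i.e. lies in the Borel `B_d(R)`). -/
def IsUpperTri {d : ℕ} {R : Type} [CommRing R] (g : GL (Fin d) R) : Prop :=
  ∀ i j : Fin d, j < i → (g : Matrix (Fin d) (Fin d) R) i j = 0

/-- A matrix in `GL_d(R)` is upper unitriangular (i.e. lies in `U_d(R)`). -/
def IsUniTri {d : ℕ} {R : Type} [CommRing R] (g : GL (Fin d) R) : Prop :=
  IsUpperTri g ∧ ∀ i : Fin d, (g : Matrix (Fin d) (Fin d) R) i i = 1

section QuarticKummer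

open Topology Filter

variable {F L : Type*} [Field F] [Field L] [Algebra F L]

theorem addChar_map_sum {ι A M : Type*} [AddCommMonoid A] [CommMonoid M] (ψ : AddChar A M)
    (s : Finset ι) (f : ι → A) : ψ (∑ j ∈ s, f j) = ∏ j ∈ s, ψ (f j) :=
  map_prod ψ.toMonoidHom (fun j => Multiplicative.ofAdd (f j)) s

/-- The character of `ZMod 2` sending `1` to `-1`. -/
def signChar (L : Type*) [Field L] : AddChar (ZMod 2) L :=
  AddChar.zmodChar 2 (neg_one_sq : (-1 : L) ^ 2 = 1)

theorem signChar_one : signChar L 1 = -1 := by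
  rw [signChar, AddChar.zmodChar_apply]
  simp [ZMod.val_one]

theorem signChar_sq (k : ZMod 2) : signChar L k ^ 2 = 1 := by
  rw [signChar, AddChar.zmodChar_apply, ← pow_mul, mul_comm, pow_mul, neg_one_sq, one_pow]

theorem map_signChar (g : L ≃ₐ[F] L) (k : ZMod 2) : g (signChar L k) = signChar L k := by
  rw [signChar, AddChar.zmodChar_apply, map_pow, map_neg, map_one]

theorem signChar_injective (h2 : (2 : L) ≠ 0) : Function.Injective (signChar L) := by
  have h : (1 : L) ≠ -1 := fun h => h2 (by linear_combination h)
  have key : ∀ k : ZMod 2, k = 0 ∨ k = 1 := by decide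
  intro k l hkl
  rcases key k with rfl | rfl <;> rcases key l with rfl | rfl <;>
    simp_all [signChar_one, AddChar.map_zero_eq_one, eq_comm]

theorem algebraMap_pow_four_eq_one {ζ : F} (hζ : IsPrimitiveRoot ζ 4) :
    algebraMap F L ζ ^ 4 = 1 := by
  rw [← map_pow, hζ.pow_eq_one, map_one]

/-- The character of `ZMod 4` with values in `L` defined by a primitive fourth root of unity
of `F`. -/
def quarticChar (L : Type*) [Field L] [Algebra F L] {ζ : F} (hζ : IsPrimitiveRoot ζ 4) :
    AddChar (ZMod 4) L :=
  AddChar.zmodChar 4 (algebraMap_pow_four_eq_one (L := L) hζ)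

section

variable {ζ : F} (hζ : IsPrimitiveRoot ζ 4)

theorem sq_eq_neg_one_of_isPrimitiveRoot_four {ζ : F} (hζ : IsPrimitiveRoot ζ 4) : ζ ^ 2 = -1 := by
  have h1 : ζ ^ 2 ≠ 1 := hζ.pow_ne_one_of_pos_of_lt (by norm_num) (by norm_num)
  have h2 : (ζ ^ 2 - 1) * (ζ ^ 2 + 1) = 0 := by linear_combination hζ.pow_eq_one
  rcases mul_eq_zero.mp h2 with h | h
  · exact absurd (sub_eq_zero.mp h) h1
  · exact eq_neg_of_add_eq_zero_left h

theorem map_quarticChar (g : L ≃ₐ[F] L) (k : ZMod 4) :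
    g (quarticChar L hζ k) = quarticChar L hζ k := by
  rw [quarticChar, AddChar.zmodChar_apply, map_pow, AlgEquiv.commutes]

theorem quarticChar_injective : Function.Injective (quarticChar L hζ) := by
  intro k l hkl
  have h : IsPrimitiveRoot (algebraMap F L ζ) 4 := hζ.map_of_injective (algebraMap F L).injective
  rw [quarticChar, AddChar.zmodChar_apply, AddChar.zmodChar_apply] at hkl
  exact ZMod.val_injective 4 (h.pow_inj k.val_lt l.val_lt hkl)

theorem exists_quarticChar_eq {z : L} (hz : z ^ 4 = 1) : ∃ k, quarticChar L hζ k = z := by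
  have h : IsPrimitiveRoot (algebraMap F L ζ) 4 := hζ.map_of_injective (algebraMap F L).injective
  obtain ⟨i, hi, rfl⟩ := h.eq_pow_of_pow_eq_one hz
  refine ⟨(i : ZMod 4), ?_⟩
  rw [quarticChar, AddChar.zmodChar_apply, ZMod.val_natCast, Nat.mod_eq_of_lt hi]

theorem quarticChar_sq (k : ZMod 4) :
    quarticChar L hζ k ^ 2 = signChar L (ZMod.castHom (by norm_num : (2 : ℕ) ∣ 4) (ZMod 2) k) := by
  have h : algebraMap F L ζ ^ 2 = -1 := by
    rw [← map_pow, sq_eq_neg_one_of_isPrimitiveRoot_four hζ, map_neg, map_one]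
  rw [quarticChar, AddChar.zmodChar_apply, signChar, AddChar.zmodChar_apply, ← pow_mul, mul_comm,
    pow_mul, h]
  fin_cases k
  · rfl
  · rfl
  · change (-1 : L) ^ 2 = (-1) ^ 0
    norm_num
  · change (-1 : L) ^ 3 = (-1) ^ 1
    norm_num

theorem quarticChar_mul_right_cancel {k l : ZMod 4} {z : L} (hz : z ≠ 0)
    (h : quarticChar L hζ k * z = quarticChar L hζ l * z) : k = l :=
  quarticChar_injective hζ (mul_right_cancel₀ hz h)

theorem exists_quarticChar_mul_eq {x y : L} (hy : y ≠ 0) (h : x ^ 4 = y ^ 4) :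
    ∃ k, x = quarticChar L hζ k * y := by
  obtain ⟨k, hk⟩ := exists_quarticChar_eq hζ (z := x / y)
    (by rw [div_pow, h, div_self (pow_ne_zero 4 hy)])
  exact ⟨k, by rw [hk, div_mul_cancel₀ x hy]⟩

end

theorem eventually_fixes [Algebra.IsIntegral F L] (x : L) : ∀ᶠ g in 𝓝 (1 : L ≃ₐ[F] L), g x = x :=
  (stabilizer_isOpen_of_isIntegral (K := F) (L := L) x).mem_nhds (one_mem _)

/-- Kummer theory for quadratic characters of a subgroup of a Galois group. -/
theorem exists_signChar_eigenvector [IsGalois F L] (H : Subgroup (L ≃ₐ[F] L))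
    (c : (L ≃ₐ[F] L) → ZMod 2) (hc : ∀ g ∈ H, ∀ h ∈ H, c (g * h) = c g + c h)
    (hopen : ∀ᶠ g in 𝓝 (1 : L ≃ₐ[F] L), g ∈ H ∧ c g = 0) :
    ∃ γ : L, γ ≠ 0 ∧ ∀ h ∈ H, h γ = signChar L (c h) * γ := by
  have hc1 : c 1 = 0 := by simpa using hc 1 H.one_mem 1 H.one_mem
  have hinv : ∀ g ∈ H, c g⁻¹ = c g := by
    intro g hg
    have h := hc g hg g⁻¹ (H.inv_mem hg)
    rw [mul_inv_cancel, hc1] at h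
    generalize c g = s at h
    generalize c g⁻¹ = t at h
    revert s t
    decide
  let K : Subgroup (L ≃ₐ[F] L) :=
    { carrier := {g | g ∈ H ∧ c g = 0}
      one_mem' := ⟨H.one_mem, hc1⟩
      mul_mem' := fun {g h} hg hh =>
        ⟨H.mul_mem hg.1 hh.1, by rw [hc g hg.1 h hh.1, hg.2, hh.2, add_zero]⟩
      inv_mem' := fun {g} hg => ⟨H.inv_mem hg.1, by rw [hinv g hg.1, hg.2]⟩ }
  have hKo : IsOpen (K : Set (L ≃ₐ[F] L)) := K.isOpen_of_mem_nhds (g := 1) hopen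
  have hKc : IsClosed (K : Set (L ≃ₐ[F] L)) := K.isClosed_of_isOpen hKo
  have dich : ∀ k : ZMod 2, k = 0 ∨ k = 1 := by decide
  by_cases hall : ∀ h ∈ H, c h = 0
  · exact ⟨1, one_ne_zero, fun h hh => by simp [hall h hh]⟩
  push Not at hall
  obtain ⟨σ, hσ, hσc⟩ := hall
  have hσ1 : c σ = 1 := (dich _).resolve_left hσc
  have hfix := InfiniteGalois.fixingSubgroup_fixedField (k := F) (K := L) ⟨K, hKc⟩
  have hσK : σ ∉ (IntermediateField.fixedField K).fixingSubgroup := by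
    intro h
    have h' : σ ∈ K := by
      have := hfix ▸ h
      exact this
    exact hσc h'.2
  rw [IntermediateField.mem_fixingSubgroup_iff] at hσK
  push Not at hσK
  obtain ⟨x, hx, hσx⟩ := hσK
  have hxK : ∀ g ∈ H, c g = 0 → g x = x := fun g hg hg0 => hx ⟨g, hg, hg0⟩
  have hxσ : ∀ g ∈ H, c g = 1 → g x = σ x := by
    intro g hg hg1
    have h := hxK (σ⁻¹ * g) (H.mul_mem (H.inv_mem hσ) hg)
      (by rw [hc _ (H.inv_mem hσ) _ hg, hinv σ hσ, hσ1, hg1]; decide)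
    have h' := congrArg σ h
    rwa [← AlgEquiv.mul_apply, mul_inv_cancel_left] at h'
  refine ⟨x - σ x, sub_ne_zero.mpr (Ne.symm hσx), fun h hh => ?_⟩
  have hmul : c (h * σ) = c h + 1 := by rw [hc h hh σ hσ, hσ1]
  rw [map_sub, ← AlgEquiv.mul_apply]
  rcases dich (c h) with h0 | h1
  · rw [hxK h hh h0, hxσ (h * σ) (H.mul_mem hh hσ) (by rw [hmul, h0, zero_add]), h0,
      AddChar.map_zero_eq_one, one_mul]
  · rw [hxσ h hh h1, hxK (h * σ) (H.mul_mem hh hσ) (by rw [hmul, h1]; decide), h1, signChar_one]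
    ring

/-- If the cup product of two quadratic characters `a` and `b` vanishes, then the square class
attached to `b` is a norm from the quadratic extension defined by `a`. -/
theorem exists_norm_form_of_cup_eq_zero [IsGalois F L] (h2 : (2 : L) ≠ 0)
    (a b c : (L ≃ₐ[F] L) → ZMod 2)
    (ha : ∀ g h, a (g * h) = a g + a h) (hb : ∀ g h, b (g * h) = b g + b h)
    (hc : ∀ g h, c (g * h) = c g + c h + a g * b h)
    (hopen : ∀ᶠ g in 𝓝 (1 : L ≃ₐ[F] L), a g = 0 ∧ b g = 0 ∧ c g = 0) :
    ∃ (α β : L) (x y : F), α ≠ 0 ∧ β ≠ 0 ∧ (∀ g : L ≃ₐ[F] L, g α = signChar L (a g) * α) ∧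
      (∀ g : L ≃ₐ[F] L, g β = signChar L (b g) * β) ∧
      β ^ 2 = algebraMap F L x ^ 2 - α ^ 2 * algebraMap F L y ^ 2 := by
  obtain ⟨α, hα0, hα⟩ := exists_signChar_eigenvector ⊤ a (fun g _ h _ => ha g h)
    (hopen.mono fun g hg => ⟨trivial, hg.1⟩)
  obtain ⟨β, hβ0, hβ⟩ := exists_signChar_eigenvector ⊤ b (fun g _ h _ => hb g h)
    (hopen.mono fun g hg => ⟨trivial, hg.2.1⟩)
  replace hα := fun g => hα g (Subgroup.mem_top g)
  replace hβ := fun g => hβ g (Subgroup.mem_top g)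
  have dich : ∀ k : ZMod 2, k = 0 ∨ k = 1 := by decide
  by_cases hall : ∀ g, a g = 0
  · have hβ2 : ∀ g : L ≃ₐ[F] L, g (β ^ 2) = β ^ 2 := fun g => by
      rw [map_pow, hβ, mul_pow, signChar_sq, one_mul]
    obtain ⟨x, hx⟩ := (InfiniteGalois.mem_range_algebraMap_iff_fixed ((β ^ 2 + 1) / 2)).mpr
      (fun g => by rw [map_div₀, map_add, hβ2, map_one, map_ofNat])
    obtain ⟨y, hy⟩ := (InfiniteGalois.mem_range_algebraMap_iff_fixed ((β ^ 2 - 1) / 2)).mpr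
      (fun g => by rw [map_div₀, map_sub, hβ2, map_one, map_ofNat])
    refine ⟨1, β, x, y, one_ne_zero, hβ0, fun g => by simp [hall g], hβ, ?_⟩
    rw [hx, hy]
    field_simp
    ring
  push Not at hall
  obtain ⟨σ, hσ⟩ := hall
  replace hσ : a σ = 1 := (dich _).resolve_left hσ
  have ha1 : a 1 = 0 := by simpa using ha 1 1
  have hb1 : b 1 = 0 := by simpa using hb 1 1
  have hc1 : c 1 = 0 := by simpa [ha1] using hc 1 1
  have hainv : ∀ g, a g⁻¹ = a g := fun g => by
    have h := ha g g⁻¹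
    rw [mul_inv_cancel, ha1] at h
    generalize a g = s at h
    generalize a g⁻¹ = t at h
    revert s t
    decide
  let N : Subgroup (L ≃ₐ[F] L) :=
    { carrier := {g | a g = 0}
      one_mem' := ha1
      mul_mem' := fun {g h} hg hh => by
        change a (g * h) = 0
        rw [ha, show a g = 0 from hg, show a h = 0 from hh, add_zero]
      inv_mem' := fun {g} hg => (hainv g).trans hg }
  obtain ⟨γ, hγ0, hγ⟩ := exists_signChar_eigenvector N c
    (fun g hg h _ => by rw [hc, show a g = 0 from hg, zero_mul, add_zero])
    (hopen.mono fun g hg => ⟨hg.1, hg.2.2⟩)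
  replace hγ : ∀ g : L ≃ₐ[F] L, a g = 0 → g γ = signChar L (c g) * γ := fun g hg => hγ g hg
  -- an element fixed by `N` and by `σ` lies in `F`
  have hdesc : ∀ z : L, (∀ g : L ≃ₐ[F] L, a g = 0 → g z = z) → σ z = z →
      z ∈ Set.range (algebraMap F L) := by
    intro z hN hσz
    rw [InfiniteGalois.mem_range_algebraMap_iff_fixed]
    intro g
    rcases dich (a g) with h | h
    · exact hN g h
    · have h' := congrArg σ (hN (σ⁻¹ * g) (by rw [ha, hainv, hσ, h]; decide))
      rwa [← AlgEquiv.mul_apply, mul_inv_cancel_left, hσz] at h'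
  have hσγ : ∀ g : L ≃ₐ[F] L, a g = 0 → g (σ γ) = signChar L (c g + b g) * σ γ := by
    intro g hg
    have h0 : a (σ⁻¹ * (g * σ)) = 0 := by rw [ha, ha, hainv, hσ, hg]; decide
    have hcc : c (σ⁻¹ * (g * σ)) = c g + b g := by
      have h1 := hc σ (σ⁻¹ * (g * σ))
      have h3 := hb σ (σ⁻¹ * (g * σ))
      rw [mul_inv_cancel_left, hb] at h3
      rw [mul_inv_cancel_left, hc, hσ, hg] at h1
      have h4 : b g + b g = 0 := CharTwo.add_self_eq_zero _
      linear_combination h3 - h1 - h4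
    have h := congrArg σ (hγ _ h0)
    rwa [← AlgEquiv.mul_apply, mul_inv_cancel_left, map_mul, map_signChar, hcc] at h
  have hσσ : σ (σ γ) = signChar L (b σ) * γ := by
    rw [← AlgEquiv.mul_apply, hγ (σ * σ) (by rw [ha, hσ]; decide), hc, hσ, one_mul,
      CharTwo.add_self_eq_zero, zero_add]
  have hsγ : σ γ ≠ 0 := by simpa using hγ0
  obtain ⟨w, hw⟩ := hdesc (γ * σ γ / β)
    (fun g hg => by
      rw [map_div₀, map_mul, hγ g hg, hσγ g hg, hβ, AddChar.map_add_eq_mul]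
      have h1 := signChar_sq (L := L) (c g)
      have h3 : signChar L (b g) ≠ 0 := fun h => by
        have := signChar_sq (L := L) (b g)
        simp [h] at this
      field_simp
      linear_combination h1)
    (by
      rw [map_div₀, map_mul, hσσ, hβ]
      have h3 : signChar L (b σ) ≠ 0 := fun h => by
        have := signChar_sq (L := L) (b σ)
        simp [h] at this
      field_simp)
  have hγ2 : ∀ g : L ≃ₐ[F] L, a g = 0 → g γ ^ 2 = γ ^ 2 := fun g hg => by
    rw [hγ g hg, mul_pow, signChar_sq, one_mul]
  have hσγ2 : ∀ g : L ≃ₐ[F] L, a g = 0 → g (σ γ) ^ 2 = σ γ ^ 2 := fun g hg => by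
    rw [hσγ g hg, mul_pow, signChar_sq, one_mul]
  have hσσ2 : σ (σ γ) ^ 2 = γ ^ 2 := by rw [hσσ, mul_pow, signChar_sq, one_mul]
  obtain ⟨x, hx⟩ := hdesc ((γ ^ 2 + σ γ ^ 2) / 2)
    (fun g hg => by
      rw [map_div₀, map_add, map_pow, map_pow, hγ2 g hg, hσγ2 g hg, map_ofNat])
    (by rw [map_div₀, map_add, map_pow, map_pow, hσσ2, map_ofNat, add_comm])
  obtain ⟨y, hy⟩ := hdesc ((γ ^ 2 - σ γ ^ 2) / (2 * α))
    (fun g hg => by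
      rw [map_div₀, map_sub, map_pow, map_pow, hγ2 g hg, hσγ2 g hg, map_mul, map_ofNat, hα, hg,
        AddChar.map_zero_eq_one, one_mul])
    (by
      rw [map_div₀, map_sub, map_pow, map_pow, hσσ2, map_mul, map_ofNat, hα, hσ, signChar_one]
      field_simp
      ring)
  refine ⟨α, β, x / w, y / w, hα0, hβ0, hα, hβ, ?_⟩
  rw [map_div₀, map_div₀, hx, hy, hw]
  field_simp
  ring

/-- Rescaling a solution of `b = x ^ 2 - a * y ^ 2` to a solution of `b = x ^ 4 - a * y ^ 4`. -/
theorem exists_quartic_norm_form [IsSepClosed L] (h2 : (2 : L) ≠ 0)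
    (χ ψ : (L ≃ₐ[F] L) → L) {α β : L} {x y : F} (hα0 : α ≠ 0) (hβ0 : β ≠ 0)
    (hα : ∀ g : L ≃ₐ[F] L, g α = χ g * α) (hβ : ∀ g : L ≃ₐ[F] L, g β = ψ g * β)
    (h : β ^ 2 = algebraMap F L x ^ 2 - α ^ 2 * algebraMap F L y ^ 2) :
    ∃ (α' β' : L) (x' y' : F), α' ≠ 0 ∧ β' ≠ 0 ∧
      (∀ g : L ≃ₐ[F] L, g (α' ^ 2) = χ g * α' ^ 2) ∧
      (∀ g : L ≃ₐ[F] L, g (β' ^ 2) = ψ g * β' ^ 2) ∧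
      β' ^ 4 = algebraMap F L x' ^ 4 - α' ^ 4 * algebraMap F L y' ^ 4 := by
  have : NeZero ((2 : ℕ) : L) := ⟨by exact_mod_cast h2⟩
  suffices hs : ∃ s t x' y' : F, s ≠ 0 ∧ t ≠ 0 ∧ (β * algebraMap F L t) ^ 2 =
      algebraMap F L x' ^ 4 - (α * algebraMap F L s) ^ 2 * algebraMap F L y' ^ 4 by
    obtain ⟨s, t, x', y', hs, ht, he⟩ := hs
    obtain ⟨α', hα'⟩ := IsSepClosed.exists_pow_nat_eq (α * algebraMap F L s) 2
    obtain ⟨β', hβ'⟩ := IsSepClosed.exists_pow_nat_eq (β * algebraMap F L t) 2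
    have hs' : algebraMap F L s ≠ 0 := by simpa using hs
    have ht' : algebraMap F L t ≠ 0 := by simpa using ht
    refine ⟨α', β', x', y', ?_, ?_, fun g => ?_, fun g => ?_, ?_⟩
    · rintro rfl
      exact mul_ne_zero hα0 hs' (by rw [← hα']; ring)
    · rintro rfl
      exact mul_ne_zero hβ0 ht' (by rw [← hβ']; ring)
    · rw [hα', map_mul, hα, AlgEquiv.commutes, mul_assoc]
    · rw [hβ', map_mul, hβ, AlgEquiv.commutes, mul_assoc]
    · rw [show β' ^ 4 = (β' ^ 2) ^ 2 by ring, show α' ^ 4 = (α' ^ 2) ^ 2 by ring, hα', hβ', he]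
  by_cases hx : x = 0
  · subst hx
    have hy : y ≠ 0 := by
      rintro rfl
      exact pow_ne_zero 2 hβ0 (by simpa using h)
    refine ⟨y, 1, 0, 1, hy, one_ne_zero, ?_⟩
    simp only [map_zero, map_one] at h ⊢
    linear_combination h
  have hx' : algebraMap F L x ≠ 0 := by simpa using hx
  by_cases hy : y = 0
  · subst hy
    refine ⟨1, x⁻¹, 1, 0, one_ne_zero, inv_ne_zero hx, ?_⟩
    simp only [map_zero, map_one, map_inv₀] at h ⊢
    field_simp
    linear_combination h
  · refine ⟨y / x, x⁻¹, 1, 1, div_ne_zero hy hx, inv_ne_zero hx, ?_⟩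
    simp only [map_one, map_inv₀, map_div₀]
    field_simp
    linear_combination h

/-- The quartic Kummer character of an element whose square is an eigenvector of a quadratic
character. -/
theorem exists_quartic_kummer_character [Algebra.IsIntegral F L] {ζ : F}
    (hζ : IsPrimitiveRoot ζ 4) (h2 : (2 : L) ≠ 0)
    (χ : (L ≃ₐ[F] L) → ZMod 2) {α : L} (hα0 : α ≠ 0)
    (hα : ∀ g : L ≃ₐ[F] L, g (α ^ 2) = signChar L (χ g) * α ^ 2) :
    ∃ A : (L ≃ₐ[F] L) → ZMod 4, (∀ g, g α = quarticChar L hζ (A g) * α) ∧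
      (∀ g h, A (g * h) = A g + A h) ∧
      (∀ g, ZMod.castHom (by norm_num : (2 : ℕ) ∣ 4) (ZMod 2) (A g) = χ g) ∧
      ∀ᶠ g in 𝓝 (1 : L ≃ₐ[F] L), A g = 0 := by
  have hex : ∀ g : L ≃ₐ[F] L, ∃ k, g α = quarticChar L hζ k * α := fun g => by
    refine exists_quarticChar_mul_eq hζ hα0 ?_
    rw [show g α ^ 4 = g (α ^ 2) ^ 2 by rw [map_pow]; ring, hα, mul_pow, signChar_sq]
    ring
  choose A hA using hex
  refine ⟨A, hA, fun g h => ?_, fun g => ?_, (eventually_fixes α).mono fun g hg => ?_⟩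
  · refine quarticChar_mul_right_cancel hζ hα0 ?_
    rw [← hA, AlgEquiv.mul_apply, hA h, map_mul, map_quarticChar, hA g, AddChar.map_add_eq_mul]
    ring
  · refine signChar_injective h2 (mul_right_cancel₀ (pow_ne_zero 2 hα0) ?_)
    rw [← hα, ← quarticChar_sq hζ, map_pow, hA, mul_pow]
  · refine quarticChar_mul_right_cancel hζ hα0 ?_
    rw [← hA, hg, AddChar.map_zero_eq_one, one_mul]

/-- An explicit trivialization of the mod 4 cup product of the Kummer characters of `a` and
`x ^ 4 - a * y ^ 4`. -/
theorem exists_cochain_of_quartic_norm_form [Algebra.IsIntegral F L] [IsSepClosed L]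
    {ζ : F} (hζ : IsPrimitiveRoot ζ 4) (h2 : (2 : L) ≠ 0)
    (a b : (L ≃ₐ[F] L) → ZMod 2) {α β : L} {x y : F}
    (hα0 : α ≠ 0) (hβ0 : β ≠ 0)
    (hα : ∀ g : L ≃ₐ[F] L, g (α ^ 2) = signChar L (a g) * α ^ 2)
    (hβ : ∀ g : L ≃ₐ[F] L, g (β ^ 2) = signChar L (b g) * β ^ 2)
    (hn : β ^ 4 = algebraMap F L x ^ 4 - α ^ 4 * algebraMap F L y ^ 4) :
    ∃ A B C : (L ≃ₐ[F] L) → ZMod 4,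
      (∀ g h, A (g * h) = A g + A h) ∧ (∀ g h, B (g * h) = B g + B h) ∧
      (∀ g h, C (g * h) = C g + C h + A g * B h) ∧
      (∀ g, ZMod.castHom (by norm_num : (2 : ℕ) ∣ 4) (ZMod 2) (A g) = a g) ∧
      (∀ g, ZMod.castHom (by norm_num : (2 : ℕ) ∣ 4) (ZMod 2) (B g) = b g) ∧
      ∀ᶠ g in 𝓝 (1 : L ≃ₐ[F] L), A g = 0 ∧ B g = 0 ∧ C g = 0 := by
  have : NeZero ((4 : ℕ) : L) := ⟨by
    rw [show ((4 : ℕ) : L) = 2 * 2 by norm_num]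
    exact mul_ne_zero h2 h2⟩
  obtain ⟨A, hA, hAmul, hAa, hA0⟩ := exists_quartic_kummer_character hζ h2 a hα0 hα
  set ψ := quarticChar L hζ with hψ
  let u : ZMod 4 → L := fun j => algebraMap F L x - ψ j * (algebraMap F L y * α)
  have hgu : ∀ (g : L ≃ₐ[F] L) j, g (u j) = u (j + A g) := fun g j => by
    simp only [u, map_sub, map_mul, AlgEquiv.commutes, hA, AddChar.map_add_eq_mul, hψ,
      map_quarticChar]
    ring
  have hprod : ∏ j, u j = β ^ 4 := by
    have hi : algebraMap F L ζ ^ 2 = -1 := by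
      rw [← map_pow, sq_eq_neg_one_of_isPrimitiveRoot_four hζ, map_neg, map_one]
    have e0 : ψ 0 = 1 := AddChar.map_zero_eq_one _
    have e1 : ψ 1 = algebraMap F L ζ := by
      rw [hψ, quarticChar, AddChar.zmodChar_apply, ZMod.val_one'' (by norm_num), pow_one]
    have e2 : ψ 2 = -1 := by
      rw [← hi, ← e1, sq, ← AddChar.map_add_eq_mul]
      rfl
    have e3 : ψ 3 = -algebraMap F L ζ := by
      rw [← e1, ← neg_one_mul, ← e2, ← AddChar.map_add_eq_mul]
      rfl
    rw [hn]
    change ∏ j : Fin 4, u j = _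
    rw [Fin.prod_univ_four]
    change u 0 * u 1 * u 2 * u 3 = _
    simp only [u, e0, e1, e2, e3]
    linear_combination (-(algebraMap F L y * α) ^ 2 * algebraMap F L x ^ 2 +
      (algebraMap F L y * α) ^ 4) * hi
  choose γ hγ using fun j => IsSepClosed.exists_pow_nat_eq (u j) 4
  have hγ0 : ∀ j, γ j ≠ 0 := fun j h => by
    have hu : u j = 0 := by rw [← hγ j, h, zero_pow (by norm_num)]
    exact pow_ne_zero 4 hβ0 (by rw [← hprod]; exact Finset.prod_eq_zero (Finset.mem_univ j) hu)
  have hex : ∀ (g : L ≃ₐ[F] L) j, ∃ k, g (γ j) = ψ k * γ (j + A g) := fun g j => by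
    refine exists_quarticChar_mul_eq hζ (hγ0 _) ?_
    rw [← map_pow, hγ, hγ, hgu]
  choose k hk using hex
  have hkmul : ∀ g h j, k (g * h) j = k h j + k g (j + A h) := fun g h j => by
    refine quarticChar_mul_right_cancel hζ (hγ0 (j + A (g * h))) ?_
    rw [← hψ, ← hk, AlgEquiv.mul_apply, hk h, map_mul, hψ, map_quarticChar, ← hψ, hk g,
      AddChar.map_add_eq_mul, hAmul, add_assoc j, add_comm (A h)]
    ring
  have hshift : ∀ (s : ZMod 4) (f : ZMod 4 → ZMod 4), ∑ j, f (j + s) = ∑ j, f j := fun s f =>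
    Equiv.sum_comp (Equiv.addRight s) f
  have hk0 : ∀ᶠ g in 𝓝 (1 : L ≃ₐ[F] L), ∀ j, k g j = 0 := by
    have hall : ∀ᶠ g in 𝓝 (1 : L ≃ₐ[F] L), ∀ j, g (γ j) = γ j :=
      eventually_all.mpr fun j => eventually_fixes (γ j)
    filter_upwards [hall, hA0] with g hg hAg j
    refine quarticChar_mul_right_cancel hζ (hγ0 j) ?_
    have h := hk g j
    rw [hAg, add_zero, hg] at h
    rw [← hψ, ← h, AddChar.map_zero_eq_one, one_mul]
  have hBmul : ∀ g h, ∑ j, k (g * h) j = ∑ j, k g j + ∑ j, k h j := fun g h => by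
    simp only [hkmul, Finset.sum_add_distrib, hshift (A h) (k g)]
    ring
  refine ⟨A, fun g => ∑ j, k g j, fun g => ∑ j, j * k g j + A g * ∑ j, k g j, hAmul, hBmul,
    fun g h => ?_, hAa, fun g => ?_, ?_⟩
  · have hC : ∑ j, j * k (g * h) j = ∑ j, j * k h j + ∑ j, j * k g j - A h * ∑ j, k g j := by
      rw [← hshift (A h) (fun j => j * k g j), ← hshift (A h) (k g), Finset.mul_sum,
        ← Finset.sum_add_distrib, ← Finset.sum_sub_distrib]
      refine Finset.sum_congr rfl fun j _ => ?_
      rw [hkmul]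
      ring
    simp only [hC, hBmul, hAmul]
    ring
  · set δ := ∏ j, γ j with hδ
    have hgδ : g δ = ψ (∑ j, k g j) * δ := by
      rw [hδ, map_prod, addChar_map_sum]
      simp only [hk, Finset.prod_mul_distrib]
      congr 1
      exact Equiv.prod_comp (Equiv.addRight (A g)) γ
    have hδ4 : δ ^ 4 = β ^ 4 := by
      rw [hδ, ← Finset.prod_pow]
      simp only [hγ, hprod]
    obtain ⟨m, hm⟩ := exists_quarticChar_mul_eq hζ hβ0 hδ4
    have hδ0 : δ ≠ 0 := Finset.prod_ne_zero_iff.mpr fun j _ => hγ0 j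
    refine signChar_injective h2 (mul_right_cancel₀ (pow_ne_zero 2 hδ0) ?_)
    rw [← quarticChar_sq hζ, ← mul_pow, ← hψ, ← hgδ, hm, map_mul, map_quarticChar, mul_pow,
      ← map_pow g, hβ]
    ring
  · filter_upwards [hA0, hk0] with g hAg hkg
    simp [hAg, hkg]

end QuarticKummer

section Unitriangular

/-- The homomorphism into `GL 3` with the given superdiagonal entries and corner. -/
def unitriangularHom {G R : Type*} [Group G] [CommRing R] (A B C : G → R)
    (hA : ∀ g h, A (g * h) = A g + A h) (hB : ∀ g h, B (g * h) = B g + B h)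
    (hC : ∀ g h, C (g * h) = C g + C h + A g * B h) : G →* GL (Fin 3) R :=
  MonoidHom.toHomUnits
    { toFun := fun g => !![1, A g, C g; 0, 1, B g; 0, 0, 1]
      map_one' := by
        have hA1 : A 1 = 0 := by simpa using hA 1 1
        have hB1 : B 1 = 0 := by simpa using hB 1 1
        have hC1 : C 1 = 0 := by simpa [hA1] using hC 1 1
        rw [hA1, hB1, hC1, Matrix.one_fin_three]
      map_mul' := fun g h => by
        rw [hA, hB, hC]
        ext i j
        fin_cases i <;> fin_cases j <;> simp [Matrix.mul_apply, Fin.sum_univ_three] <;> ring }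

theorem coe_unitriangularHom {G R : Type*} [Group G] [CommRing R] (A B C : G → R)
    (hA : ∀ g h, A (g * h) = A g + A h) (hB : ∀ g h, B (g * h) = B g + B h)
    (hC : ∀ g h, C (g * h) = C g + C h + A g * B h) (g : G) :
    (unitriangularHom A B C hA hB hC g : Matrix (Fin 3) (Fin 3) R) =
      !![1, A g, C g; 0, 1, B g; 0, 0, 1] :=
  rfl

theorem IsUniTri.eq_of {R : Type} [CommRing R] {g : GL (Fin 3) R} (hg : IsUniTri g) :
    (g : Matrix (Fin 3) (Fin 3) R) = !![1, g 0 1, g 0 2; 0, 1, g 1 2; 0, 0, 1] := by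
  obtain ⟨h, h'⟩ := hg
  ext i j
  fin_cases i <;> fin_cases j <;>
    first
    | rfl
    | exact h' _
    | exact h _ _ (by decide)

end Unitriangular

theorem stmt_1 (F : Type) [Field F] (hchar : (2 : F) ≠ 0)
    (ζ : F) (hζ : IsPrimitiveRoot ζ 4)
    (ρ : AbsGal F →* GL (Fin 3) (ZMod 2))
    (hcont : IsOpen (ρ.ker : Set (AbsGal F)))
    (htri : ∀ g, IsUniTri (ρ g)) :
    ∃ ρ₂ : AbsGal F →* GL (Fin 3) (ZMod 4),
      IsOpen (ρ₂.ker : Set (AbsGal F)) ∧ (∀ g, IsUniTri (ρ₂ g)) ∧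
      (Matrix.GeneralLinearGroup.map
        (ZMod.castHom (by norm_num : (2 : ℕ) ∣ 4) (ZMod 2))).comp ρ₂ = ρ := by
  have h2 : (2 : SeparableClosure F) ≠ 0 := by
    rw [← map_ofNat (algebraMap F (SeparableClosure F)) 2]
    exact (map_ne_zero _).mpr hchar
  have : NeZero ((2 : ℕ) : SeparableClosure F) := ⟨by exact_mod_cast h2⟩
  let a : AbsGal F → ZMod 2 := fun g => ρ g 0 1
  let b : AbsGal F → ZMod 2 := fun g => ρ g 1 2
  let c : AbsGal F → ZMod 2 := fun g => ρ g 0 2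
  have hρ : ∀ g, (ρ g : Matrix (Fin 3) (Fin 3) (ZMod 2)) = !![1, a g, c g; 0, 1, b g; 0, 0, 1] :=
    fun g => (htri g).eq_of
  have hmul : ∀ g h, (ρ (g * h) : Matrix (Fin 3) (Fin 3) (ZMod 2)) =
      !![1, a g, c g; 0, 1, b g; 0, 0, 1] * !![1, a h, c h; 0, 1, b h; 0, 0, 1] := fun g h => by
    rw [map_mul, Units.val_mul, hρ, hρ]
  have ha : ∀ g h, a (g * h) = a g + a h := fun g h => by
    refine (congrFun (congrFun (hmul g h) 0) 1).trans ?_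
    simp [Matrix.mul_apply, Fin.sum_univ_three, add_comm]
  have hb : ∀ g h, b (g * h) = b g + b h := fun g h => by
    refine (congrFun (congrFun (hmul g h) 1) 2).trans ?_
    simp [Matrix.mul_apply, Fin.sum_univ_three, add_comm]
  have hc : ∀ g h, c (g * h) = c g + c h + a g * b h := fun g h => by
    refine (congrFun (congrFun (hmul g h) 0) 2).trans ?_
    simp [Matrix.mul_apply, Fin.sum_univ_three]
    ring
  have hopen : ∀ᶠ g in nhds (1 : AbsGal F), a g = 0 ∧ b g = 0 ∧ c g = 0 := by
    filter_upwards [hcont.mem_nhds (one_mem ρ.ker)] with g hg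
    have hg' : ρ g = 1 := hg
    simp [a, b, c, hg']
  obtain ⟨α, β, x, y, hα0, hβ0, hα, hβ, hn⟩ :=
    exists_norm_form_of_cup_eq_zero h2 a b c ha hb hc hopen
  obtain ⟨α', β', x', y', hα0', hβ0', hα', hβ', hn'⟩ :=
    exists_quartic_norm_form h2 (fun g => signChar _ (a g)) (fun g => signChar _ (b g))
      hα0 hβ0 hα hβ hn
  obtain ⟨A, B, C, hA, hB, hC, hAa, hBb, hABC⟩ :=
    exists_cochain_of_quartic_norm_form hζ h2 a b hα0' hβ0' hα' hβ' hn'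
  let π : ZMod 4 →+* ZMod 2 := ZMod.castHom (by norm_num : (2 : ℕ) ∣ 4) (ZMod 2)
  have hAπ : ∀ g, π (A g) = a g := hAa
  have hBπ : ∀ g, π (B g) = b g := hBb
  -- the discrepancy in the corner is a quadratic character, which lifts to a quartic one
  let χ : AbsGal F → ZMod 2 := fun g => c g - π (C g)
  obtain ⟨ε, hε0, hε⟩ := exists_signChar_eigenvector ⊤ χ
    (fun g _ h _ => by
      simp only [χ, hc, hC, map_add, map_mul, hAπ, hBπ]
      ring)
    (by
      filter_upwards [hopen, hABC] with g hg hg'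
      exact ⟨trivial, by simp only [χ, hg.2.2, hg'.2.2, map_zero, sub_zero]⟩)
  obtain ⟨η, hη⟩ := IsSepClosed.exists_pow_nat_eq ε 2
  obtain ⟨X, -, hX, hXχ, hX0⟩ := exists_quartic_kummer_character hζ h2 χ (α := η)
    (by
      rintro rfl
      exact hε0 (by rw [← hη]; ring))
    (fun g => by rw [hη]; exact hε g trivial)
  have hXπ : ∀ g, π (X g) = χ g := hXχ
  refine ⟨unitriangularHom A B (fun g => C g + X g) hA hB (fun g h => by rw [hC, hX]; ring),
    ?_, fun g => ⟨?_, ?_⟩, ?_⟩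
  · refine Subgroup.isOpen_of_mem_nhds _ (g := 1) ?_
    filter_upwards [hABC, hX0] with g hg hXg
    refine MonoidHom.mem_ker.mpr (Units.ext ?_)
    rw [coe_unitriangularHom, hg.1, hg.2.1, hg.2.2, hXg, add_zero, Units.val_one,
      Matrix.one_fin_three]
  · intro i j hij
    rw [coe_unitriangularHom]
    fin_cases i <;> fin_cases j <;> first | rfl | exact absurd hij (by decide)
  · intro i
    rw [coe_unitriangularHom]
    fin_cases i <;> rfl
  · ext g i j
    change π ((unitriangularHom A B (fun g => C g + X g) hA hB _ g :
      Matrix (Fin 3) (Fin 3) (ZMod 4)) i j) = (ρ g : Matrix (Fin 3) (Fin 3) (ZMod 2)) i j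
    rw [coe_unitriangularHom, hρ]
    fin_cases i <;> fin_cases j <;> simp [hAπ, hBπ, hXπ, χ]
end

section
/- Let F be any field. Then every continuous homomorphism Gal(F_s/F) → B_4(ℤ/2) admits a lift to a continuous homomorphism Gal(F_s/F) → B_4(ℤ/4) along the reduction ℤ/4 → ℤ/2. -/
open scoped MatrixGroups

open Topology

section Descent

variable {G L T : Type*} [Group G] [Fintype G] [Field L] [MulSemiringAction G L]
  [FaithfulSMul G L]

/-- Dedekind independence: a combination of the elements of `G` with nonzero coefficient at `1`
is not identically zero on `L`. -/
lemma exists_sum_mul_smul_ne_zero (c : G → L) (hc : c 1 ≠ 0) :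
    ∃ u : L, ∑ g, c g * g • u ≠ 0 := by
  by_contra! h
  have hinj : Function.Injective
      (fun g : G => ((MulSemiringAction.toRingHom G L g : L →+* L) : L →* L)) := by
    intro g h hgh
    refine FaithfulSMul.eq_of_smul_eq_smul (α := L) fun a => ?_
    exact DFunLike.congr_fun hgh a
  have hli := (linearIndependent_monoidHom L L).comp _ hinj
  refine hc (Fintype.linearIndependent_iff.mp hli c ?_ 1)
  funext u
  simpa [Finset.sum_apply] using h u

/-- Hilbert 90 for the units of the functions on a finite `G`-set with translation action. -/
lemma exists_smul_eq_mul_of_cocycle [AddCommGroup T] (φ : G → T)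
    (hφ : ∀ g h, φ (g * h) = φ g + φ h)
    (x : G → T → L) (hx0 : ∀ g s, x g s ≠ 0)
    (hx : ∀ g h s, x (g * h) s = x g s * g • x h (s - φ g)) :
    ∃ β : T → L, (∀ s, β s ≠ 0) ∧ ∀ g s, g • β (s - φ g) = x g s * β s := by
  classical
  let f : Additive G →+ T := AddMonoidHom.mk' (fun g => φ g.toMul) fun g h => hφ _ _
  have hf : ∀ g, φ g ∈ f.range := fun g => ⟨Additive.ofMul g, rfl⟩
  have h1 : φ 1 = 0 := by simpa using hφ 1 1
  let r : T → T := fun s => (QuotientAddGroup.mk (s := f.range) s).out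
  have hr : ∀ h s, r (s - φ h) = r s := fun h s => by
    have : (QuotientAddGroup.mk (s := f.range) (s - φ h)) = QuotientAddGroup.mk s := by
      rw [QuotientAddGroup.eq]; simpa using hf h
    simp only [r, this]
  have hrr : ∀ s, r (r s) = r s := fun s => by
    simp only [r, QuotientAddGroup.out_eq']
  have hrs : ∀ s, ∃ g, s - φ g = r s := fun s => by
    have : (QuotientAddGroup.mk (s := f.range) (r s)) = QuotientAddGroup.mk s :=
      QuotientAddGroup.out_eq' _
    rw [QuotientAddGroup.eq] at this
    obtain ⟨g, hg⟩ := this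
    refine ⟨g.toMul, ?_⟩
    have hg' : φ g.toMul = -r s + s := hg
    rw [hg']; abel
  have hu : ∀ t, ∃ u : L, ∑ g, (if φ g = 0 then x g t else 0) * g • u ≠ 0 := fun t =>
    exists_sum_mul_smul_ne_zero _ (by simpa [h1] using hx0 1 t)
  choose u hu using hu
  let b : T → L := fun s => ∑ g, (if φ g = s - r s then x g s else 0) * g • u (r s)
  have hb : ∀ h s, x h s * h • b (s - φ h) = b s := fun h s => by
    simp only [b, hr, Finset.smul_sum, Finset.mul_sum]
    refine Fintype.sum_equiv (Equiv.mulLeft h) _ _ fun g => ?_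
    have : φ g = s - φ h - r s ↔ φ h + φ g = s - r s := by
      constructor <;> intro H
      · rw [H]; abel
      · rw [eq_sub_of_add_eq' H]; abel
    simp only [Equiv.coe_mulLeft, hφ, this, smul_mul', mul_smul, hx]
    split_ifs <;> simp [mul_assoc]
  have hb0 : ∀ s, b s ≠ 0 := fun s => by
    obtain ⟨g, hg⟩ := hrs s
    rw [← hb g s, hg]
    refine mul_ne_zero (hx0 _ _) ?_
    rw [Ne, smul_eq_zero_iff_eq]
    simpa [b, hrr] using hu (r s)
  refine ⟨fun s => (b s)⁻¹, fun s => inv_ne_zero (hb0 s), fun g s => ?_⟩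
  beta_reduce
  rw [← hb g s, mul_inv, ← mul_assoc, mul_inv_cancel₀ (hx0 g s), one_mul, smul_inv'']

/-- Additive Hilbert 90 for functions on a finite `G`-set with translation action. -/
lemma exists_smul_eq_add_of_cocycle [AddCommGroup T] (φ : G → T) (x : G → T → L)
    (hx : ∀ g h s, x (g * h) s = x g s + g • x h (s - φ g)) :
    ∃ β : T → L, ∀ g s, g • β (s - φ g) = x g s + β s := by
  obtain ⟨u, hu⟩ := exists_sum_mul_smul_ne_zero (fun _ : G => (1 : L)) one_ne_zero
  simp only [one_mul] at hu
  set t := ∑ g : G, g • u with ht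
  have hfix : ∀ h : G, h • t = t := fun h => by
    rw [ht, Finset.smul_sum]
    exact Fintype.sum_equiv (Equiv.mulLeft h) _ _ fun g => by simp [mul_smul]
  refine ⟨fun s => -(∑ g, x g s * g • u) / t, fun h s => ?_⟩
  have key : h • (∑ g, x g (s - φ h) * g • u) = (∑ g, x g s * g • u) - x h s * t := by
    rw [Finset.smul_sum, ht, Finset.mul_sum, eq_sub_iff_add_eq,
      ← Equiv.sum_comp (Equiv.mulLeft h) (fun g => x h s * g • u),
      ← Equiv.sum_comp (Equiv.mulLeft h) (fun g => x g s * g • u), ← Finset.sum_add_distrib]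
    refine Finset.sum_congr rfl fun g _ => ?_
    simp only [Equiv.coe_mulLeft, hx, smul_mul', mul_smul]
    ring
  beta_reduce
  rw [div_eq_mul_inv, smul_mul', smul_neg, key, smul_inv'', hfix]
  field_simp
  ring

end Descent

section Kummer

variable {F Ω T : Type*} [Field F] [Field Ω] [Algebra F Ω]

lemma eventually_restrictNormalHom_eq_one (E : IntermediateField F Ω) [FiniteDimensional F E]
    [Normal F E] :
    ∀ᶠ g : Ω ≃ₐ[F] Ω in 𝓝 1, AlgEquiv.restrictNormalHom E g = 1 := by
  filter_upwards [E.fixingSubgroup_isOpen.mem_nhds (one_mem _)] with g hg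
  ext z
  exact (AlgEquiv.restrictNormal_commutes g E z).trans (hg z)

lemma eventually_apply_eq [Algebra.IsIntegral F Ω] (z : Ω) :
    ∀ᶠ g : Ω ≃ₐ[F] Ω in 𝓝 1, g z = z :=
  (stabilizer_isOpen_of_isIntegral (K := F) z).mem_nhds (one_mem _)

lemma restrictNormalHom_smul_coe (E : IntermediateField F Ω) [Normal F E] (g : Ω ≃ₐ[F] Ω)
    (z : E) : ((AlgEquiv.restrictNormalHom E g • z : E) : Ω) = g z :=
  AlgEquiv.restrictNormal_commutes g E z

variable [AddCommGroup T] [Finite T] [IsGalois F Ω] [IsSepClosed Ω]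
  (E : IntermediateField F Ω) [FiniteDimensional F E] [Normal F E]
  (φ : (E ≃ₐ[F] E) → T) (hφ : ∀ g h, φ (g * h) = φ g + φ h)
  (x : (E ≃ₐ[F] E) → T → ZMod 2) (hx : ∀ g h s, x (g * h) s = x g s + x h (s - φ g))

include hφ hx

/-- In characteristic different from two, a cocycle modulo `2` with values in functions on a
translation set lifts to a cocycle modulo `4` twisted by a character (the cyclotomic one). -/
lemma exists_cocycle_lift_of_two_ne_zero (h2 : (2 : Ω) ≠ 0) :
    ∃ (ω : (Ω ≃ₐ[F] Ω) → ZMod 4) (y : (Ω ≃ₐ[F] Ω) → T → ZMod 4),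
      (∀ g h, ω (g * h) = ω g * ω h) ∧
      (∀ g h s, y (g * h) s =
        y g s + ω g * y h (s - φ (AlgEquiv.restrictNormalHom E g))) ∧
      (∀ g s, ZMod.castHom (by norm_num : 2 ∣ 4) (ZMod 2) (y g s) =
        x (AlgEquiv.restrictNormalHom E g) s) ∧
      ∀ᶠ g in 𝓝 1, ω g = 1 ∧ ∀ s, y g s = 0 := by
  have : NeZero (2 : Ω) := ⟨h2⟩
  have hneg : (-1 : Ω) ≠ 1 := fun h => h2 (by linear_combination -h)
  have hnegE : ((-1 : E) ≠ 0) := neg_ne_zero.mpr one_ne_zero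
  obtain ⟨i, hi⟩ := IsSepClosed.exists_eq_mul_self (-1 : Ω)
  have hi2 : i ^ 2 = -1 := by rw [sq, ← hi]
  have hi4 : i ^ 4 = 1 := by linear_combination (i ^ 2 - 1) * hi2
  have hprim : IsPrimitiveRoot i 4 := by
    have : orderOf i = 2 ^ (1 + 1) := orderOf_eq_prime_pow (by simpa [hi2] using hneg) hi4
    have h := IsPrimitiveRoot.orderOf i
    rwa [this] at h
  have hadd : ∀ a b : ZMod 4, i ^ (a + b).val = i ^ a.val * i ^ b.val := fun a b => by
    rw [ZMod.val_add, ← pow_add, ← pow_eq_pow_mod _ hi4]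
  have hmul : ∀ a b : ZMod 4, i ^ (a * b).val = (i ^ a.val) ^ b.val := fun a b => by
    rw [ZMod.val_mul, ← pow_mul, ← pow_eq_pow_mod _ hi4]
  have hinj : ∀ a b : ZMod 4, i ^ a.val = i ^ b.val → a = b := fun a b h =>
    ZMod.val_injective 4 (hprim.pow_inj (ZMod.val_lt a) (ZMod.val_lt b) h)
  have hsurj : ∀ z : Ω, z ^ 4 = 1 → ∃ a : ZMod 4, z = i ^ a.val := fun z hz => by
    obtain ⟨k, hk, rfl⟩ := hprim.eq_pow_of_pow_eq_one hz
    exact ⟨k, by rw [ZMod.val_cast_of_lt hk]⟩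
  have hsq : ∀ a : ZMod 4, (i ^ a.val) ^ 2 =
      (-1) ^ (ZMod.castHom (by norm_num : 2 ∣ 4) (ZMod 2) a).val := fun a => by
    have hval : (ZMod.castHom (by norm_num : 2 ∣ 4) (ZMod 2) a).val = a.val % 2 := by
      revert a; decide
    rw [hval, ← pow_eq_pow_mod _ (by norm_num), pow_right_comm, hi2]
  have hinj2 : ∀ a b : ZMod 2, (-1 : Ω) ^ a.val = (-1) ^ b.val → a = b := by
    have hb : ∀ b : ZMod 2, b = 0 ∨ b = 1 := by decide
    have hv : (1 : ZMod 2).val = 1 := rfl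
    intro a b
    rcases hb a with rfl | rfl <;> rcases hb b with rfl | rfl <;>
      simp [hv, hneg, hneg.symm]
  have hω : ∀ g : Ω ≃ₐ[F] Ω, ∃ a : ZMod 4, g i = i ^ a.val := fun g =>
    hsurj _ (by rw [← map_pow, hi4, map_one])
  choose ω hω using hω
  obtain ⟨β, hβ0, hβ⟩ := exists_smul_eq_mul_of_cocycle (L := E) φ hφ
    (fun g s => (-1) ^ (x g s).val) (fun g s => pow_ne_zero _ hnegE) (fun g h s => by
      rw [smul_pow', smul_neg, smul_one, hx, ZMod.val_add, ← pow_add,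
        ← pow_eq_pow_mod _ (by norm_num)])
  choose γ hγ using fun s => IsSepClosed.exists_eq_mul_self (β s : Ω)
  have hγ0 : ∀ s, γ s ≠ 0 := fun s h => by
    apply hβ0 s
    have := hγ s
    rw [h, mul_zero] at this
    exact_mod_cast this
  set π := AlgEquiv.restrictNormalHom (F := F) (K₁ := Ω) E with hπ
  have hγ2 : ∀ (g : Ω ≃ₐ[F] Ω) s, (g (γ (s - φ (π g))) / γ s) ^ 2 =
      (-1) ^ (x (π g) s).val := fun g s => by
    have h := congrArg (fun z : E => (z : Ω)) (hβ (π g) s)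
    beta_reduce at h
    rw [hπ, restrictNormalHom_smul_coe, ← hπ, hγ] at h
    push_cast at h
    rw [hγ s, map_mul] at h
    have := hγ0 s
    field_simp
    linear_combination h
  have hy : ∀ (g : Ω ≃ₐ[F] Ω) s, ∃ a : ZMod 4, g (γ (s - φ (π g))) / γ s = i ^ a.val :=
      fun g s => by
    refine hsurj _ ?_
    rw [show (4 : ℕ) = 2 * 2 from rfl, pow_mul, hγ2, pow_right_comm]
    norm_num
  choose y hy using hy
  have hyγ : ∀ (g : Ω ≃ₐ[F] Ω) s, g (γ (s - φ (π g))) = i ^ (y g s).val * γ s := fun g s => by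
    rw [← hy, div_mul_cancel₀ _ (hγ0 s)]
  refine ⟨ω, y, fun g h => hinj _ _ ?_, fun g h s => hinj _ _ ?_, fun g s => hinj2 _ _ ?_, ?_⟩
  · rw [hmul, ← hω, ← hω, AlgEquiv.mul_apply, hω h, map_pow]
  · rw [← hy, div_eq_iff (hγ0 s), map_mul, hφ, ← sub_sub, AlgEquiv.mul_apply, hyγ, map_mul, hyγ,
      map_pow, hω, hadd, hmul]
    ring
  · rw [← hsq, ← hy, hγ2]
  · have h1 : φ 1 = 0 := by simpa using hφ 1 1
    have hγe : ∀ᶠ g : Ω ≃ₐ[F] Ω in 𝓝 1, ∀ s, g (γ s) = γ s :=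
      Filter.eventually_all.mpr fun s => eventually_apply_eq _
    filter_upwards [eventually_apply_eq (F := F) i, hγe,
      eventually_restrictNormalHom_eq_one E] with g hgi hg hgE
    refine ⟨hinj _ _ ?_, fun s => hinj _ _ ?_⟩
    · rw [← hω, hgi]
      exact (pow_one i).symm
    · rw [← hy, hπ, hgE, h1, sub_zero, hg, div_self (hγ0 s)]
      exact (pow_zero i).symm

/-- In characteristic two, a cocycle modulo `2` with values in functions on a
translation set lifts to a cocycle modulo `4`; this is Artin-Schreier-Witt theory in length
two. -/
lemma exists_cocycle_lift_of_two_eq_zero (h2 : (2 : Ω) = 0) :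
    ∃ (y : (Ω ≃ₐ[F] Ω) → T → ZMod 4),
      (∀ g h s, y (g * h) s =
        y g s + y h (s - φ (AlgEquiv.restrictNormalHom E g))) ∧
      (∀ g s, ZMod.castHom (by norm_num : 2 ∣ 4) (ZMod 2) (y g s) =
        x (AlgEquiv.restrictNormalHom E g) s) ∧
      ∀ᶠ g in 𝓝 1, ∀ s, y g s = 0 := by
  have h1 : φ 1 = 0 := by simpa using hφ 1 1
  have : CharP Ω 2 := CharTwo.of_one_ne_zero_of_two_eq_zero one_ne_zero h2
  have : CharP E 2 := (algebraMap E Ω).charP (algebraMap E Ω).injective 2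
  let ι : ZMod 2 →+* Ω := ZMod.castHom dvd_rfl Ω
  let ιE : ZMod 2 →+* E := ZMod.castHom dvd_rfl E
  have hι : ∀ a, ((ιE a : E) : Ω) = ι a := fun a =>
    RingHom.congr_fun (Subsingleton.elim ((algebraMap E Ω).comp ιE) ι) a
  have hfix : ∀ (g : Ω ≃ₐ[F] Ω) a, g (ι a) = ι a := fun g a =>
    RingHom.congr_fun (Subsingleton.elim ((g : Ω →+* Ω).comp ι) ι) a
  have hfixE : ∀ (g : E ≃ₐ[F] E) a, g • (ιE a) = ιE a := fun g a =>
    RingHom.congr_fun (Subsingleton.elim ((g : E →+* E).comp ιE) ιE) a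
  have hιsq : ∀ a, ι a ^ 2 = ι a := fun a => by
    rw [← map_pow]; congr 1; revert a; decide
  have hsurj : ∀ z : Ω, z ^ 2 + z = 0 → ∃ a, z = ι a := fun z hz => by
    have hz' : z * (z + 1) = 0 := by linear_combination hz
    rcases mul_eq_zero.mp hz' with h | h
    · exact ⟨0, by rw [h, map_zero]⟩
    · exact ⟨1, by rw [map_one]; linear_combination h - h2⟩
  obtain ⟨β', hβ'⟩ := exists_smul_eq_add_of_cocycle (L := E) φ (fun g s => ιE (x g s))
    (fun g h s => by rw [hx, map_add, hfixE])
  set π := AlgEquiv.restrictNormalHom (F := F) (K₁ := Ω) E with hπ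
  let β : T → Ω := fun s => β' s
  have hβ : ∀ g s, g (β (s - φ (π g))) = ι (x (π g) s) + β s := fun g s => by
    have h := congrArg (fun z : E => (z : Ω)) (hβ' (π g) s)
    beta_reduce at h
    rw [hπ, restrictNormalHom_smul_coe, ← hπ] at h
    push_cast at h
    rwa [hι] at h
  have hγ : ∀ s, ∃ γ : Ω, γ ^ 2 + γ = β s ^ 3 + β s ^ 2 := fun s => by
    obtain ⟨γ, hγ⟩ := IsSepClosed.exists_root_C_mul_X_pow_add_C_mul_X_add_C' (p := 2) 2 1 1
      (β s ^ 3 + β s ^ 2) dvd_rfl le_rfl one_ne_zero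
    refine ⟨γ, ?_⟩
    linear_combination hγ - (β s ^ 3 + β s ^ 2) * h2
  choose γ hγ using hγ
  have hz : ∀ g s, ∃ a, g (γ (s - φ (π g))) + γ s + β s * ι (x (π g) s) = ι a := fun g s => by
    refine hsurj _ ?_
    have h := congrArg g (hγ (s - φ (π g)))
    simp only [map_add, map_pow, hβ] at h
    have h' := hγ s
    have hs := hιsq (x (π g) s)
    set X := ι (x (π g) s)
    set Γ := g (γ (s - φ (π g)))
    set B := β s
    linear_combination h + h' + (B ^ 2 + 3 * B + X + 1 + 1) * hs +
      (Γ * γ s + Γ * B * X + γ s * B * X + 2 * B ^ 3 + B ^ 2 + 5 * B ^ 2 * X + 5 * B * X + X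
        - (2 * B * X + 3 * B ^ 2 * X + B ^ 3)) * h2
  choose z hz using hz
  have hzγ : ∀ g s, g (γ (s - φ (π g))) = ι (z g s) + γ s + β s * ι (x (π g) s) := fun g s => by
    linear_combination hz g s - (γ s + β s * ι (x (π g) s)) * h2
  have hzmul : ∀ g h s, z (g * h) s =
      z g s + z h (s - φ (π g)) + x (π g) s * x (π h) (s - φ (π g)) := fun g h s => by
    apply ι.injective
    rw [← hz, map_mul, hφ, ← sub_sub, AlgEquiv.mul_apply, hzγ]
    simp only [map_add, map_mul, hzγ, hβ, hfix, hx]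
    linear_combination (γ s + β s * ι (x (π g) s) + β s * ι (x (π h) (s - φ (π g)))) * h2
  let e : ZMod 2 → ZMod 2 → ZMod 4 := fun a b => a.val + 2 * b.val
  have he : ∀ a b a' b', e (a + a') (b + b' + a * a') = e a b + e a' b' := by decide
  refine ⟨fun g s => e (x (π g) s) (z g s), fun g h s => ?_, fun g s => ?_, ?_⟩
  · beta_reduce
    rw [hzmul, map_mul, hx, he]
  · beta_reduce
    generalize x (π g) s = a
    generalize z g s = b
    revert a b; decide
  · have hγe : ∀ᶠ g : Ω ≃ₐ[F] Ω in 𝓝 1, ∀ s, g (γ s) = γ s :=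
      Filter.eventually_all.mpr fun s => eventually_apply_eq _
    have hx1 : ∀ s, x 1 s = 0 := fun s => by simpa [h1] using hx 1 1 s
    filter_upwards [hγe, eventually_restrictNormalHom_eq_one E] with g hg hgE s
    have hz0 : z g s = 0 := by
      apply ι.injective
      rw [← hz, hπ, hgE, h1, sub_zero, hg, hx1, map_zero]
      linear_combination γ s * h2
    rw [hπ, hgE, hx1, hz0]
    rfl

/-- A cocycle modulo `2` with values in functions on a translation set lifts to a cocycle
modulo `4`, up to twisting by a character. -/
lemma exists_cocycle_lift :
    ∃ (ω : (Ω ≃ₐ[F] Ω) → ZMod 4) (y : (Ω ≃ₐ[F] Ω) → T → ZMod 4),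
      (∀ g h, ω (g * h) = ω g * ω h) ∧
      (∀ g h s, y (g * h) s =
        y g s + ω g * y h (s - φ (AlgEquiv.restrictNormalHom E g))) ∧
      (∀ g s, ZMod.castHom (by norm_num : 2 ∣ 4) (ZMod 2) (y g s) =
        x (AlgEquiv.restrictNormalHom E g) s) ∧
      ∀ᶠ g in 𝓝 1, ω g = 1 ∧ ∀ s, y g s = 0 := by
  by_cases h2 : (2 : Ω) = 0
  · obtain ⟨y, hy, hyx, hy1⟩ := exists_cocycle_lift_of_two_eq_zero E φ hφ x hx h2
    exact ⟨fun _ => 1, y, fun _ _ => (one_mul 1).symm, fun g h s => by rw [hy, one_mul], hyx,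
      hy1.mono fun g hg => ⟨rfl, hg⟩⟩
  · exact exists_cocycle_lift_of_two_ne_zero E φ hφ x hx h2

end Kummer

/-- Block upper triangular matrices with block-diagonal part given by (twisted) translations,
written in coordinates in which the translations are upper triangular. -/
def flagMatrix {R : Type*} [CommRing R] (w : R) (a d : ZMod 2) (x : ZMod 2 × ZMod 2 → R) :
    Matrix (Fin 4) (Fin 4) R :=
  let α : R := if a = 0 then 0 else 1
  let δ : R := if d = 0 then 0 else 1
  let y11 := x (1, 0) + x (1, 1)
  let y12 := x (1, 1)
  let y21 := x (0, 0) + x (0, 1) - x (1, 0) - x (1, 1)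
  let y22 := x (0, 1) - x (1, 1)
  !![w, w * α, y11, y11 * δ + y12 * (1 - 2 * δ);
     0, w * (1 - 2 * α), y21, y21 * δ + y22 * (1 - 2 * δ);
     0, 0, 1, δ;
     0, 0, 0, 1 - 2 * δ]

set_option maxHeartbeats 2000000 in
lemma flagMatrix_mul {R : Type*} [CommRing R] (w w' : R) (a d a' d' : ZMod 2)
    (x x' : ZMod 2 × ZMod 2 → R) :
    flagMatrix w a d x * flagMatrix w' a' d' x' =
      flagMatrix (w * w') (a + a') (d + d') (fun s => x s + w * x' (s - (a, d))) := by
  have h2 : ∀ b : ZMod 2, b = 0 ∨ b = 1 := by decide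
  have e : (1 + 1 : ZMod 2) = 0 := by decide
  have e' : (- 1 : ZMod 2) = 1 := by decide
  rcases h2 a with rfl | rfl <;> rcases h2 d with rfl | rfl <;>
  rcases h2 a' with rfl | rfl <;> rcases h2 d' with rfl | rfl <;>
  · ext i j
    fin_cases i <;> fin_cases j <;>
      simp [flagMatrix, Matrix.mul_apply, Fin.sum_univ_four, e, e', Prod.zero_eq_mk] <;> ring

lemma flagMatrix_one {R : Type*} [CommRing R] :
    flagMatrix (1 : R) 0 0 (fun _ => 0) = 1 := by
  ext i j
  fin_cases i <;> fin_cases j <;> simp [flagMatrix]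

lemma flagMatrix_map {R S : Type*} [CommRing R] [CommRing S] (f : R →+* S) (w : R)
    (a d : ZMod 2) (x : ZMod 2 × ZMod 2 → R) :
    (flagMatrix w a d x).map f = flagMatrix (f w) a d (fun s => f (x s)) := by
  ext i j
  fin_cases i <;> fin_cases j <;> simp [flagMatrix, apply_ite f, map_ofNat f]

lemma flagMatrix_apply_of_lt {R : Type*} [CommRing R] (w : R)
    (a d : ZMod 2) (x : ZMod 2 × ZMod 2 → R) (i j : Fin 4) (h : j < i) :
    flagMatrix w a d x i j = 0 := by
  fin_cases i <;> fin_cases j <;> simp_all [flagMatrix]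

lemma flagMatrix_injective {a d a' d' : ZMod 2} {x x' : ZMod 2 × ZMod 2 → ZMod 2}
    (h : flagMatrix 1 a d x = flagMatrix 1 a' d' x') : a = a' ∧ d = d' ∧ x = x' := by
  have h2 : (2 : ZMod 2) = 0 := by decide
  have hite : ∀ b : ZMod 2, (if b = 0 then (0 : ZMod 2) else 1) = b := by decide
  have e := fun i j => congrFun (congrFun h i) j
  have e01 := e 0 1
  have e23 := e 2 3
  have e02 := e 0 2
  have e03 := e 0 3
  have e12 := e 1 2
  have e13 := e 1 3
  simp [flagMatrix, hite, h2] at e01 e23 e02 e03 e12 e13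
  subst e01 e23
  rw [e02] at e03
  rw [e12] at e13
  have a11 : x (1, 1) = x' (1, 1) := add_left_cancel e03
  have a01 : x (0, 1) = x' (0, 1) := by
    have := add_left_cancel e13
    rw [a11] at this
    exact sub_left_injective this
  have a10 : x (1, 0) = x' (1, 0) := by
    rw [a11] at e02; exact add_right_cancel e02
  have a00 : x (0, 0) = x' (0, 0) := by
    rw [a11, a01, a10] at e12
    exact add_right_cancel (sub_left_injective (sub_left_injective e12))
  refine ⟨rfl, rfl, funext ?_⟩
  rintro ⟨i, j⟩
  have h2 : ∀ b : ZMod 2, b = 0 ∨ b = 1 := by decide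
  rcases h2 i with rfl | rfl <;> rcases h2 j with rfl | rfl <;> assumption

lemma exists_eq_flagMatrix (g : GL (Fin 4) (ZMod 2))
    (hg : ∀ i j : Fin 4, j < i → (g : Matrix (Fin 4) (Fin 4) (ZMod 2)) i j = 0) :
    ∃ a d x, (g : Matrix (Fin 4) (Fin 4) (ZMod 2)) = flagMatrix 1 a d x := by
  have h2 : (2 : ZMod 2) = 0 := by decide
  have hite : ∀ b : ZMod 2, (if b = 0 then (0 : ZMod 2) else 1) = b := by decide
  have hone : ∀ b : ZMod 2, b ≠ 0 → b = 1 := by decide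
  set m := (g : Matrix (Fin 4) (Fin 4) (ZMod 2)) with hm
  have hdet : m.det ≠ 0 := ((Matrix.isUnit_iff_isUnit_det _).mp g.isUnit).ne_zero
  rw [Matrix.det_of_isUpperTriangular (fun i j h => hg i j h), Finset.prod_ne_zero_iff] at hdet
  have hd : ∀ i, m i i = 1 := fun i => hone _ (hdet i (Finset.mem_univ i))
  let y12 := m 0 3 - m 0 2 * m 2 3
  let y22 := m 1 3 - m 1 2 * m 2 3
  refine ⟨m 0 1, m 2 3, fun s =>
    if s.1 = 0 then (if s.2 = 0 then m 0 2 + m 1 2 - y12 - y22 else y12 + y22)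
    else (if s.2 = 0 then m 0 2 - y12 else y12), ?_⟩
  have lo := fun (i j : Fin 4) (h : j < i) => hg i j h
  ext i j
  fin_cases i <;> fin_cases j <;>
    first
    | exact hd _
    | exact lo _ _ (by decide)
    | (simp [flagMatrix, hite, h2, y12, y22, hd])

theorem stmt_2 (F : Type) [Field F]
    (ρ : AbsGal F →* GL (Fin 4) (ZMod 2))
    (hcont : IsOpen (ρ.ker : Set (AbsGal F)))
    (htri : ∀ g, IsUpperTri (ρ g)) :
    ∃ ρ₂ : AbsGal F →* GL (Fin 4) (ZMod 4),
      IsOpen (ρ₂.ker : Set (AbsGal F)) ∧ (∀ g, IsUpperTri (ρ₂ g)) ∧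
      (Matrix.GeneralLinearGroup.map
        (ZMod.castHom (by norm_num : (2 : ℕ) ∣ 4) (ZMod 2))).comp ρ₂ = ρ := by
  obtain ⟨E, hEfin, hEnormal, hE⟩ := (krullTopology_mem_nhds_one_iff_of_normal F
    (SeparableClosure F) _).mp (hcont.mem_nhds (one_mem ρ.ker))
  let π : AbsGal F →* (E ≃ₐ[F] E) := AlgEquiv.restrictNormalHom E
  have hπ : Function.Surjective π := AlgEquiv.restrictNormalHom_surjective (SeparableClosure F)
  have hker : π.ker ≤ ρ.ker := fun g hg => hE fun z => by
    have h : π g = 1 := hg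
    have h' := restrictNormalHom_smul_coe E g z
    rw [show AlgEquiv.restrictNormalHom E g = 1 from h, one_smul] at h'
    exact h'.symm
  let ρ' : (E ≃ₐ[F] E) →* GL (Fin 4) (ZMod 2) := π.liftOfSurjective hπ ⟨ρ, hker⟩
  have hρ' : ∀ g, ρ' (π g) = ρ g := fun g =>
    π.liftOfRightInverse_comp_apply _ (Function.rightInverse_surjInv hπ) ⟨ρ, hker⟩ g
  have hflag : ∀ g, ∃ a d x, (ρ' g : Matrix (Fin 4) (Fin 4) (ZMod 2)) = flagMatrix 1 a d x :=
    fun g => by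
      obtain ⟨g, rfl⟩ := hπ g
      exact exists_eq_flagMatrix _ (by rw [hρ']; exact htri g)
  choose a d x hflag using hflag
  have hmul : ∀ g h, a (g * h) = a g + a h ∧ d (g * h) = d g + d h ∧
      x (g * h) = fun s => x g s + 1 * x h (s - (a g, d g)) := fun g h => by
    apply flagMatrix_injective
    rw [← hflag, map_mul, Units.val_mul, hflag, hflag, flagMatrix_mul, one_mul]
  have ha1 : a 1 = 0 := by simpa using (hmul 1 1).1
  have hd1 : d 1 = 0 := by simpa using (hmul 1 1).2.1
  obtain ⟨ω, y, hω, hy, hyx, hev⟩ := exists_cocycle_lift (Ω := SeparableClosure F) E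
    (fun g => (a g, d g)) (fun g h => by rw [(hmul g h).1, (hmul g h).2.1, Prod.mk_add_mk]) x
    (fun g h s => by simp only [(hmul g h).2.2, one_mul])
  have hflag1 : ∀ g, π g = 1 → ω g = 1 → (∀ s, y g s = 0) →
      flagMatrix (ω g) (a (π g)) (d (π g)) (y g) = 1 := fun g hg hωg hyg => by
    rw [hg, hωg, ha1, hd1, show y g = fun _ => 0 from funext hyg, flagMatrix_one]
  have hω1 : ω 1 = 1 := hev.self_of_nhds.1
  have hωcast : ∀ g, ZMod.castHom (by norm_num : 2 ∣ 4) (ZMod 2) (ω g) = 1 := fun g => by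
    have h := hω g g⁻¹
    rw [mul_inv_cancel, hω1] at h
    generalize ω g = u at h ⊢
    generalize ω g⁻¹ = v at h
    revert u v; decide
  let m : AbsGal F →* Matrix (Fin 4) (Fin 4) (ZMod 4) :=
    { toFun := fun g => flagMatrix (ω g) (a (π g)) (d (π g)) (y g)
      map_one' := hflag1 1 (map_one π) hω1 hev.self_of_nhds.2
      map_mul' := fun g h => by
        rw [flagMatrix_mul, map_mul, (hmul _ _).1, (hmul _ _).2.1, hω]
        congr 1
        exact funext fun s => hy g h s }
  refine ⟨m.toHomUnits, ?_, fun g i j hij => flagMatrix_apply_of_lt _ _ _ _ i j hij, ?_⟩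
  · refine Subgroup.isOpen_of_mem_nhds _ (g := 1) ?_
    filter_upwards [hev, eventually_restrictNormalHom_eq_one E] with g hg hgE
    exact Units.ext (hflag1 g hgE hg.1 hg.2)
  · refine MonoidHom.ext fun g => Units.ext ?_
    rw [← hρ', hflag]
    refine (flagMatrix_map _ _ _ _ _).trans ?_
    rw [hωcast]
    congr 1
    exact funext fun s => hyx g s
end

section
/- Let F be any field. Then every continuous homomorphism Gal(F_s/F) → GL_4(ℤ/2) admits a lift to a continuous homomorphism Gal(F_s/F) → GL_4(ℤ/4) along the reduction ℤ/4 → ℤ/2. -/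
open scoped MatrixGroups

open Filter Topology

/-- Reduction `ℤ/4 → ℤ/2`. -/
abbrev redFourTwo : ZMod 4 →+* ZMod 2 := ZMod.castHom (by norm_num : (2 : ℕ) ∣ 4) (ZMod 2)

/-- Every continuous homomorphism to `ℤ/2` lifts to a continuous `1`-cocycle with values in
`ℤ/4` twisted by `χ`. -/
def HasModFourLifts {L : Type} [Group L] [TopologicalSpace L] (χ : L →* (ZMod 4)ˣ) : Prop :=
  ∀ φ : L → ZMod 2, (∀ g h, φ (g * h) = φ g + φ h) → (∀ᶠ u in 𝓝 1, φ u = 0) →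
    ∃ C : L → ZMod 4, (∀ g h, C (g * h) = C g + χ g * C h) ∧ (∀ᶠ u in 𝓝 1, C u = 0) ∧
      ∀ g, redFourTwo (C g) = φ g

section Field

variable {F : Type} [Field F]

lemma AbsGal.eventually_apply_eq (y : SeparableClosure F) :
    ∀ᶠ u : AbsGal F in 𝓝 1, u y = y := by
  have h := stabilizer_isOpen_of_isIntegral (K := F) (L := SeparableClosure F) y
  exact h.mem_nhds (one_mem _)

variable {L : Type} [Group L] [TopologicalSpace L] [IsTopologicalGroup L]

/-- An element generating the quadratic extension cut out by a nontrivial homomorphism to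
`ℤ/2`, together with its conjugate. -/
lemma exists_conjugate_pair (j : L →* AbsGal F) (hj : IsOpenEmbedding j)
    (φ : L → ZMod 2) (hφ : ∀ g h, φ (g * h) = φ g + φ h) (hφ0 : ∀ᶠ u in 𝓝 1, φ u = 0)
    (hne : ∃ l, φ l ≠ 0) :
    ∃ z w : SeparableClosure F, z ≠ w ∧ (∀ l, φ l = 0 → j l z = z ∧ j l w = w) ∧
      (∀ l, φ l = 1 → j l z = w ∧ j l w = z) := by
  obtain ⟨l₀, hl₀⟩ := hne
  have h01 : ∀ x : ZMod 2, x ≠ 0 → x = 1 := by decide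
  replace hl₀ := h01 _ hl₀
  have h1 : φ 1 = 0 := by simpa using hφ 1 1
  have hinv : ∀ g, φ g⁻¹ = φ g := by
    intro g
    have h := hφ g⁻¹ g
    rw [inv_mul_cancel, h1] at h
    exact (by decide : ∀ x y : ZMod 2, 0 = x + y → x = y) _ _ h
  let K : Subgroup L :=
    { carrier := {l | φ l = 0}
      one_mem' := h1
      mul_mem' := fun {a b} ha hb => by
        simp only [Set.mem_ofPred_eq] at *
        rw [hφ, ha, hb, add_zero]
      inv_mem' := fun {a} ha => by
        simp only [Set.mem_ofPred_eq] at *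
        rw [hinv, ha] }
  have hK : IsOpen (K : Set L) := K.isOpen_of_mem_nhds (g := 1) hφ0
  have hKj : IsOpen ((K.map j : Subgroup (AbsGal F)) : Set (AbsGal F)) := by
    rw [Subgroup.coe_map]
    exact hj.isOpenMap _ hK
  have hgal := InfiniteGalois.fixingSubgroup_fixedField
    (⟨K.map j, Subgroup.isClosed_of_isOpen _ hKj⟩ : ClosedSubgroup (AbsGal F))
  have hz : ∃ z : SeparableClosure F, (∀ l, φ l = 0 → j l z = z) ∧ j l₀ z ≠ z := by
    by_contra hcon
    push Not at hcon
    have hmem : j l₀ ∈ K.map j := by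
      have : j l₀ ∈ (IntermediateField.fixedField (K.map j)).fixingSubgroup := by
        rw [IntermediateField.mem_fixingSubgroup_iff]
        intro x hx
        apply hcon
        intro l hl
        rw [IntermediateField.mem_fixedField_iff] at hx
        exact hx _ ⟨l, hl, rfl⟩
      rw [hgal] at this
      exact this
    obtain ⟨k, hk, hk'⟩ := hmem
    rw [hj.injective hk'] at hk
    have : φ l₀ = 0 := hk
    rw [this] at hl₀
    exact zero_ne_one hl₀
  obtain ⟨z, hz, hz'⟩ := hz
  have two : (1 : ZMod 2) + 1 = 0 := by decide
  refine ⟨z, j l₀ z, fun h => hz' h.symm, fun l hl => ⟨hz l hl, ?_⟩, fun l hl => ⟨?_, ?_⟩⟩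
  · have := hz (l₀⁻¹ * l * l₀) (by rw [hφ, hφ, hinv, hl₀, hl, add_zero, two])
    have h2 : j l (j l₀ z) = j l₀ (j (l₀⁻¹ * l * l₀) z) := by
      simp only [← AlgEquiv.mul_apply, ← map_mul]
      congr 2; group
    rw [h2, this]
  · have := hz (l₀⁻¹ * l) (by rw [hφ, hinv, hl₀, hl, two])
    have h2 : j l z = j l₀ (j (l₀⁻¹ * l) z) := by
      simp only [← AlgEquiv.mul_apply, ← map_mul]
      congr 2; group
    rw [h2, this]
  · have := hz (l * l₀) (by rw [hφ, hl₀, hl, two])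
    rw [map_mul, AlgEquiv.mul_apply] at this
    exact this

lemma hasModFourLifts_of_two_eq_zero (h2 : (2 : F) = 0) (j : L →* AbsGal F)
    (hj : IsOpenEmbedding j) : HasModFourLifts (1 : L →* (ZMod 4)ˣ) := by
  intro φ hφ hφ0
  by_cases hne : ∃ l, φ l ≠ 0
  swap
  · push Not at hne
    exact ⟨0, by simp, by simp, fun g => by simp [hne g]⟩
  obtain ⟨z, w, hzw, hz0, hz1⟩ := exists_conjugate_pair j hj φ hφ hφ0 hne
  have h01 : ∀ x : ZMod 2, x = 0 ∨ x = 1 := by decide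
  have : CharP F 2 := CharTwo.of_one_ne_zero_of_two_eq_zero one_ne_zero h2
  have : CharP (SeparableClosure F) 2 := charP_of_injective_algebraMap
    (algebraMap F (SeparableClosure F)).injective 2
  let ι : ZMod 2 →+* SeparableClosure F := ZMod.castHom dvd_rfl _
  have hι : Function.Injective ι := ι.injective
  have hjι : ∀ l a, j l (ι a) = ι a := by
    intro l a
    rcases h01 a with rfl | rfl <;> simp
  have hzw' : z + w ≠ 0 := by
    intro h
    exact hzw (CharTwo.add_eq_zero.mp h)
  obtain ⟨x, hx⟩ : ∃ x : SeparableClosure F, ∀ l, j l x = x + ι (φ l) := by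
    refine ⟨z / (z + w), fun l => ?_⟩
    rcases h01 (φ l) with h | h
    · simp [h, hz0 l h]
    · rw [h, map_div₀, map_add, (hz1 l h).1, (hz1 l h).2, map_one]
      rw [add_comm w z, div_add_one hzw', ← add_assoc, CharTwo.add_self_eq_zero, zero_add]
  have two : (2 : SeparableClosure F) = 0 := CharTwo.two_eq_zero
  obtain ⟨y, hy⟩ : ∃ y : SeparableClosure F, y * y + y = (x * x + x) * x := by
    obtain ⟨y, hy⟩ := IsSepClosed.exists_root_C_mul_X_pow_add_C_mul_X_add_C (k := SeparableClosure F)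
      (n := 2) 1 1 ((x * x + x) * x) (by exact_mod_cast two) le_rfl one_ne_zero
    exact ⟨y, by linear_combination hy - (x * x + x) * x * two⟩
  have hψ : ∀ l, ∃ a : ZMod 2, j l y = y + ι (φ l) * x + ι a := by
    intro l
    have hy' := congrArg (j l) hy
    simp only [map_add, map_mul, hx] at hy'
    have hd : (j l y + y + ι (φ l) * x) * (j l y + y + ι (φ l) * x + 1) = 0 := by
      rcases h01 (φ l) with h | h <;> rw [h] at hy' ⊢ <;>
        simp only [map_zero, map_one, zero_mul, one_mul, add_zero] at hy' ⊢
      · linear_combination hy' + hy + (j l y * y + x * x * x + x * x) * two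
      · linear_combination hy' + hy +
          (j l y * y + j l y * x + y * x + x * x * x + 2 * x * x + x
            + (1 + 2 * x + x * x)) * two
    rcases mul_eq_zero.mp hd with h | h
    · exact ⟨0, by rw [map_zero]; linear_combination h - (y + ι (φ l) * x) * two⟩
    · exact ⟨1, by rw [map_one]; linear_combination h - (y + ι (φ l) * x + 1) * two⟩
  choose ψ hψ using hψ
  have hψmul : ∀ g h, ψ (g * h) = ψ g + ψ h + φ g * φ h := by
    intro g h
    apply hι
    have e := hψ (g * h)
    rw [map_mul, AlgEquiv.mul_apply, hψ h, map_add, map_add, map_mul, hψ g, hx, hjι, hjι, hφ] at e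
    simp only [map_add, map_mul] at e ⊢
    linear_combination -e
  refine ⟨fun l => (φ l).val + 2 * (ψ l).val, fun g h => ?_, ?_, fun g => ?_⟩
  · simp only [hφ, hψmul, MonoidHom.one_apply, Units.val_one, one_mul]
    generalize φ g = a, φ h = b, ψ g = c, ψ h = d
    revert a b c d
    decide
  · have hcont : Tendsto j (𝓝 1) (𝓝 1) := by
      simpa using hj.continuous.tendsto 1
    filter_upwards [hφ0, hcont.eventually (AbsGal.eventually_apply_eq y)] with u hu hu'
    have e := hψ u
    rw [hu', hu, map_zero, zero_mul, add_zero] at e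
    have : ψ u = 0 := hι (by rw [map_zero]; linear_combination -e)
    simp [hu, this]
  · beta_reduce
    generalize φ g = a, ψ g = b
    revert a b
    decide

/-- The powers of `i`, indexed by `ℤ/4`. -/
def powFour {E : Type} [Monoid E] (i : E) (k : ZMod 4) : E := i ^ k.val

lemma powFour_add {E : Type} [Monoid E] {i : E} (hi : i ^ 4 = 1) (k l : ZMod 4) :
    powFour i (k + l) = powFour i k * powFour i l := by
  rw [powFour, ZMod.val_add, ← pow_eq_pow_mod _ hi, pow_add]
  rfl

lemma powFour_injective {E : Type} [Field E] (h2 : (2 : E) ≠ 0) {i : E} (hi : i * i = -1) :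
    Function.Injective (powFour i) := by
  have hi4 : i ^ 4 = 1 := by linear_combination (i * i - 1) * hi
  have key : ∀ k, powFour i k = 1 → k = 0 := by
    intro k hk
    fin_cases k
    · rfl
    · have h : i ^ 1 = 1 := hk
      exact absurd (by linear_combination hi - (i + 1) * h) h2
    · have h : i ^ 2 = 1 := hk
      exact absurd (by linear_combination hi - h) h2
    · have h : i ^ 3 = 1 := hk
      exact absurd (by linear_combination (i - i * i + 1) * hi + (i - 1) * h) h2
  intro k l h
  have hl : powFour i l ≠ 0 := pow_ne_zero _ (by rintro rfl; simp at hi)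
  refine sub_eq_zero.mp (key _ (mul_right_cancel₀ hl ?_))
  rw [← powFour_add hi4, sub_add_cancel, h, one_mul]

lemma exists_cyclotomic_of_two_ne_zero (h2 : (2 : F) ≠ 0) :
    ∃ χ : AbsGal F →* (ZMod 4)ˣ, (∀ᶠ u in 𝓝 1, χ u = 1) ∧
      ∀ (L : Type) [Group L] [TopologicalSpace L] [IsTopologicalGroup L] (j : L →* AbsGal F),
        IsOpenEmbedding j → HasModFourLifts (χ.comp j) := by
  have h2' : (2 : SeparableClosure F) ≠ 0 := by
    intro h
    apply h2
    apply (algebraMap F (SeparableClosure F)).injective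
    rw [map_ofNat, h, map_zero]
  have : NeZero (2 : SeparableClosure F) := ⟨h2'⟩
  obtain ⟨i, hi⟩ := IsSepClosed.exists_eq_mul_self (-1 : SeparableClosure F)
  replace hi := hi.symm
  have hi4 : i ^ 4 = 1 := by linear_combination (i * i - 1) * hi
  have hinj := powFour_injective h2' hi
  have hi_ne : i ≠ -i := by
    intro h
    have : 2 * i = 0 := by linear_combination h
    rcases mul_eq_zero.mp this with h | h
    · exact h2' h
    · rw [h] at hi; simp at hi
  have hsi : ∀ σ : AbsGal F, σ i = i ∨ σ i = -i := by
    intro σ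
    apply mul_self_eq_mul_self_iff.mp
    rw [← map_mul, hi, map_neg, map_one]
  classical
  let χ : AbsGal F →* (ZMod 4)ˣ :=
    { toFun := fun σ => if σ i = i then 1 else -1
      map_one' := by simp
      map_mul' := fun σ τ => by
        rcases hsi σ with h | h <;> rcases hsi τ with h' | h' <;>
          simp [AlgEquiv.mul_apply, h, h', hi_ne.symm] }
  have hχ : ∀ σ : AbsGal F, χ σ = if σ i = i then 1 else -1 := fun _ => rfl
  have hχ' : ∀ (σ : AbsGal F) k, σ (powFour i k) = powFour i (χ σ * k) := by
    intro σ k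
    rw [hχ]
    rcases hsi σ with h | h
    · simp [h, powFour]
    · rw [if_neg (by rw [h]; exact hi_ne.symm), powFour, map_pow, h]
      have h3 : -i = i ^ 3 := by linear_combination -i * hi
      rw [h3, ← pow_mul, pow_eq_pow_mod _ hi4, powFour]
      congr 1
  refine ⟨χ, ?_, ?_⟩
  · filter_upwards [AbsGal.eventually_apply_eq i] with u hu
    rw [hχ, if_pos hu]
  intro L _ _ _ j hj φ hφ hφ0
  by_cases hne : ∃ l, φ l ≠ 0
  swap
  · push Not at hne
    exact ⟨0, by simp, by simp, fun g => by simp [hne g]⟩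
  obtain ⟨z, w, hzw, hz0, hz1⟩ := exists_conjugate_pair j hj φ hφ hφ0 hne
  have h01 : ∀ x : ZMod 2, x = 0 ∨ x = 1 := by decide
  obtain ⟨y, hy⟩ := IsSepClosed.exists_eq_mul_self (z - w)
  have hy0 : y ≠ 0 := by
    rintro rfl
    exact hzw (by linear_combination hy)
  have hC : ∀ l, ∃ c : ZMod 4, j l y = powFour i c * y ∧
      redFourTwo c = φ l := by
    intro l
    have e := congrArg (j l) hy
    rw [map_sub, map_mul] at e
    rcases h01 (φ l) with h | h
    · rw [(hz0 l h).1, (hz0 l h).2, hy] at e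
      rw [h]
      rcases mul_self_eq_mul_self_iff.mp e.symm with h' | h'
      · exact ⟨0, by simp [h', powFour], by decide⟩
      · refine ⟨2, ?_, by decide⟩
        change _ = i ^ 2 * y
        linear_combination h' - y * hi
    · rw [(hz1 l h).1, (hz1 l h).2] at e
      rw [h]
      have e' : j l y * j l y = (i * y) * (i * y) := by
        linear_combination -e - hy - y * y * hi
      rcases mul_self_eq_mul_self_iff.mp e' with h' | h'
      · refine ⟨1, ?_, by decide⟩
        change _ = i ^ 1 * y
        linear_combination h'
      · refine ⟨3, ?_, by decide⟩
        change _ = i ^ 3 * y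
        linear_combination h' - i * y * hi
  choose C hC hCφ using hC
  refine ⟨C, fun g h => ?_, ?_, hCφ⟩
  · apply hinj
    apply mul_right_cancel₀ hy0
    rw [powFour_add hi4, ← hC, map_mul, AlgEquiv.mul_apply, hC h, map_mul, hχ', hC g]
    simp only [MonoidHom.comp_apply]
    ring
  · have hcont : Tendsto j (𝓝 1) (𝓝 1) := by
      simpa using hj.continuous.tendsto 1
    filter_upwards [hcont.eventually (AbsGal.eventually_apply_eq y)] with u hu
    apply hinj
    apply mul_right_cancel₀ hy0
    rw [← hC, hu]
    simp [powFour]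

/-- The mod-4 cyclotomic character (trivial in characteristic two), in the form of its
lifting property for all open subgroups. -/
theorem exists_cyclotomic (F : Type) [Field F] :
    ∃ χ : AbsGal F →* (ZMod 4)ˣ, (∀ᶠ u in 𝓝 1, χ u = 1) ∧
      ∀ (L : Type) [Group L] [TopologicalSpace L] [IsTopologicalGroup L] (j : L →* AbsGal F),
        IsOpenEmbedding j → HasModFourLifts (χ.comp j) := by
  by_cases h2 : (2 : F) = 0
  · exact ⟨1, by simp, fun L _ _ _ j hj => hasModFourLifts_of_two_eq_zero h2 j hj⟩
  · exact exists_cyclotomic_of_two_ne_zero h2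

end Field

section Cocycle

variable {G : Type} [Group G] [TopologicalSpace G]

lemma tendsto_conj_one [IsTopologicalGroup G] (t : G) :
    Tendsto (fun u => t⁻¹ * u * t) (𝓝 1) (𝓝 1) := by
  have h : Continuous fun u : G => t⁻¹ * u * t := by fun_prop
  simpa using h.tendsto 1

/-- The lifting property for a subgroup, phrased with functions on the ambient group. -/
lemma HasModFourLifts.exists_extension {χ : G →* (ZMod 4)ˣ} {S : Subgroup G}
    (hS : IsOpen (S : Set G)) (h : HasModFourLifts (χ.comp S.subtype))
    (φ : G → ZMod 2) (hφ : ∀ g ∈ S, ∀ h ∈ S, φ (g * h) = φ g + φ h)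
    (hφ0 : ∀ᶠ u in 𝓝 1, φ u = 0) :
    ∃ C : G → ZMod 4, (∀ g ∈ S, ∀ h ∈ S, C (g * h) = C g + χ g * C h) ∧
      (∀ᶠ u in 𝓝 1, C u = 0) ∧
      ∀ g ∈ S, redFourTwo (C g) = φ g := by
  classical
  obtain ⟨C, hC, hC0, hCφ⟩ := h (fun s => φ s) (fun g h => hφ g g.2 h h.2) (by
    have : Tendsto (fun s : S => (s : G)) (𝓝 1) (𝓝 1) := continuous_subtype_val.tendsto 1
    exact this.eventually hφ0)
  refine ⟨fun g => if hg : g ∈ S then C ⟨g, hg⟩ else 0, ?_, ?_, ?_⟩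
  · intro g hg h hh
    simp only [hg, hh, S.mul_mem hg hh, dif_pos]
    exact hC ⟨g, hg⟩ ⟨h, hh⟩
  · have h1 : ∀ᶠ u in 𝓝 (1 : G), ∀ hu : u ∈ S, C ⟨u, hu⟩ = 0 := by
      have := (hS.isOpenEmbedding_subtypeVal.map_nhds_eq (1 : S))
      rw [show ((1 : S) : G) = 1 from rfl] at this
      rw [← this, eventually_map]
      filter_upwards [hC0] with u hu _ using hu
    filter_upwards [h1] with u hu
    split_ifs with h
    · exact hu h
    · rfl
  · intro g hg
    simp only [hg, dif_pos]
    exact hCφ ⟨g, hg⟩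

/-- Shapiro's lemma combined with the lifting property: cocycles on the action groupoid of a
discrete `G`-set lift from `ℤ/2` to `ℤ/4` twisted by `χ`. -/
lemma exists_lift_groupoid_cocycle [IsTopologicalGroup G] {Z : Type} [MulAction G Z]
    (hZ : ∀ z : Z, ∀ᶠ u : G in 𝓝 1, u • z = z)
    {χ : G →* (ZMod 4)ˣ} (hχ : ∀ᶠ u in 𝓝 1, χ u = 1)
    (hlift : ∀ S : Subgroup G, IsOpen (S : Set G) → HasModFourLifts (χ.comp S.subtype))
    (φ : G → Z → ZMod 2) (hφ : ∀ g h z, φ (g * h) z = φ g (h • z) + φ h z)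
    (hφ0 : ∀ z, ∀ᶠ u in 𝓝 1, φ u z = 0) :
    ∃ Φ : G → Z → ZMod 4, (∀ g h z, Φ (g * h) z = Φ g (h • z) + χ g * Φ h z) ∧
      (∀ z, ∀ᶠ u in 𝓝 1, Φ u z = 0) ∧
      ∀ g z, redFourTwo (Φ g z) = φ g z := by
  let r : Z → Z := fun z => (Quotient.mk (MulAction.orbitRel G Z) z).out
  have hr : ∀ (g : G) z, r (g • z) = r z := by
    intro g z
    have : Quotient.mk (MulAction.orbitRel G Z) (g • z) = Quotient.mk _ z :=
      Quotient.sound (MulAction.mem_orbit z g)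
    simp only [r, this]
  have hrt : ∀ z, ∃ t : G, t • r z = z := by
    intro z
    have : z ∈ MulAction.orbit G (r z) := by
      have := Quotient.mk_out (s := MulAction.orbitRel G Z) z
      exact MulAction.mem_orbit_symm.mp (MulAction.orbitRel_apply.mp this)
    exact this
  choose t ht using hrt
  have hstab : ∀ z : Z, IsOpen (MulAction.stabilizer G z : Set G) := fun z =>
    Subgroup.isOpen_of_mem_nhds _ (g := 1) (hZ z)
  have hex := fun z => (hlift _ (hstab z)).exists_extension (hstab z) (fun g => φ g z)
    (fun g _ h hh => by rw [hφ, MulAction.mem_stabilizer_iff.mp hh]) (hφ0 z)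
  choose C hC hC0 hCφ using hex
  let p : Z → ZMod 4 := fun z => ((φ (t z) (r z)).val : ZMod 4)
  have hp : ∀ z, redFourTwo (p z) = φ (t z) (r z) := by
    intro z
    simp only [p]
    generalize φ (t z) (r z) = a
    revert a
    decide
  have hs : ∀ g z, (t (g • z))⁻¹ * g * t z ∈ MulAction.stabilizer G (r z) := by
    intro g z
    rw [MulAction.mem_stabilizer_iff, mul_smul, mul_smul, ht, inv_smul_eq_iff, ← hr g z, ht]
  have hunit : ∀ u : (ZMod 4)ˣ, redFourTwo u = 1 := by
    decide
  have hχ1 : ∀ g z, (χ (t (g • z)) : ZMod 4) * χ ((t (g • z))⁻¹ * g * t z) = χ g * χ (t z) := by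
    intro g z
    rw [← Units.val_mul, ← Units.val_mul, ← map_mul, ← map_mul]
    congr 2
    group
  refine ⟨fun g z => p (g • z) + χ (t (g • z)) * C (r z) ((t (g • z))⁻¹ * g * t z) - χ g * p z,
    ?_, ?_, ?_⟩
  · intro g h z
    have e := hC (r z) _ (by rw [← hr h z]; exact hs g (h • z)) _ (hs h z)
    have e' : (t (g • h • z))⁻¹ * g * t (h • z) * ((t (h • z))⁻¹ * h * t z) =
      (t ((g * h) • z))⁻¹ * (g * h) * t z := by
        rw [mul_smul]; group
    rw [e'] at e
    simp only [hr, mul_smul] at e ⊢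
    rw [e, map_mul χ g h, Units.val_mul]
    linear_combination (C (r z) ((t (h • z))⁻¹ * h * t z)) * hχ1 g (h • z)
  · intro z
    filter_upwards [hχ, hZ z, (tendsto_conj_one (t z)).eventually (hC0 (r z))] with u h1 h2 h3
    rw [h2, h3, h1]
    simp
  · intro g z
    rw [map_sub, map_add, map_mul, map_mul, hunit, hunit, hp, hp, hCφ _ _ (hs g z), hr]
    have e1 := hφ (t (g • z)) ((t (g • z))⁻¹ * g * t z) (r z)
    rw [MulAction.mem_stabilizer_iff.mp (hs g z)] at e1
    have e2 := hφ g (t z) (r z)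
    rw [ht] at e2
    have e3 : t (g • z) * ((t (g • z))⁻¹ * g * t z) = g * t z := by group
    rw [e3] at e1
    linear_combination e2 - e1

end Cocycle

section Averaging

variable {n : Type} [Fintype n] [DecidableEq n]

lemma exists_matrix_lift (A : Matrix n n (ZMod 2)) :
    ∃ B : Matrix n n (ZMod 4), redFourTwo.mapMatrix B = A := by
  refine ⟨A.map fun a => (a.val : ZMod 4), ?_⟩
  ext i j
  simp only [RingHom.mapMatrix_apply, Matrix.map_apply]
  generalize A i j = a
  revert a
  decide

lemma exists_GL_lift (A : GL n (ZMod 2)) :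
    ∃ B : GL n (ZMod 4), Matrix.GeneralLinearGroup.map redFourTwo B = A := by
  obtain ⟨B, hB⟩ := exists_matrix_lift (A : Matrix n n (ZMod 2))
  have hdet : IsUnit B.det := by
    have h1 : IsUnit (redFourTwo B.det) := by
      rw [RingHom.map_det, hB]
      exact (Matrix.isUnit_iff_isUnit_det _).mp A.isUnit
    revert h1
    generalize B.det = d
    revert d
    decide
  refine ⟨Matrix.GeneralLinearGroup.mk'' B hdet, ?_⟩
  ext i j
  exact congrFun (congrFun hB i) j

lemma mul_eq_zero_of_mapMatrix_eq_zero {A B : Matrix n n (ZMod 4)}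
    (hA : redFourTwo.mapMatrix A = 0) (hB : redFourTwo.mapMatrix B = 0) : A * B = 0 := by
  ext i j
  rw [Matrix.mul_apply]
  refine Finset.sum_eq_zero fun k _ => ?_
  have h1 : redFourTwo (A i k) = 0 := congrFun (congrFun hA i) k
  have h2 : redFourTwo (B k j) = 0 := congrFun (congrFun hB k) j
  revert h1 h2
  generalize A i k = a, B k j = b
  revert a b
  decide

variable {G : Type} [Group G]

/-- The average of a family of lifts satisfying a groupoid cocycle condition over a finite
`G`-set of odd cardinality is a homomorphism. -/
lemma average_mul {X : Type} [Fintype X] [MulAction G X] (hX : ((Fintype.card X : ℕ) : ZMod 4) *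
    (Fintype.card X : ℕ) = 1) (A : G → Matrix n n (ZMod 2)) (e : G → X → Matrix n n (ZMod 4))
    (heA : ∀ g x, redFourTwo.mapMatrix (e g x) = A g)
    (he : ∀ g h x, e (g * h) x = e g (h • x) * e h x) (g h : G) :
    (Fintype.card X : ZMod 4) • ∑ x, e (g * h) x =
      ((Fintype.card X : ZMod 4) • ∑ x, e g x) * ((Fintype.card X : ZMod 4) • ∑ x, e h x) := by
  set N : ZMod 4 := (Fintype.card X : ZMod 4)
  obtain ⟨P, hP⟩ := exists_matrix_lift (A g)
  obtain ⟨Q, hQ⟩ := exists_matrix_lift (A h)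
  have hα : ∀ x, redFourTwo.mapMatrix (e g x - P) = 0 := fun x => by rw [map_sub, heA, hP, sub_self]
  have hβ : ∀ x, redFourTwo.mapMatrix (e h x - Q) = 0 := fun x => by rw [map_sub, heA, hQ, sub_self]
  have hg : ∑ x, e g x = N • P + ∑ x, (e g x - P) := by
    rw [Finset.sum_sub_distrib, Finset.sum_const, Finset.card_univ, ← Nat.cast_smul_eq_nsmul (ZMod 4)]
    abel
  have hh : ∑ x, e h x = N • Q + ∑ x, (e h x - Q) := by
    rw [Finset.sum_sub_distrib, Finset.sum_const, Finset.card_univ, ← Nat.cast_smul_eq_nsmul (ZMod 4)]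
    abel
  have hgh : ∑ x, e (g * h) x =
      N • (P * Q) + (∑ x, (e g x - P)) * Q + P * ∑ x, (e h x - Q) := by
    have : ∀ x, e (g * h) x = P * Q + (e g (h • x) - P) * Q + P * (e h x - Q) := by
      intro x
      have h0 := mul_eq_zero_of_mapMatrix_eq_zero (hα (h • x)) (hβ x)
      rw [he, ← sub_eq_zero, ← h0]
      noncomm_ring
    rw [Finset.sum_congr rfl fun x _ => this x, Finset.sum_add_distrib, Finset.sum_add_distrib,
      Finset.sum_const, Finset.card_univ, ← Nat.cast_smul_eq_nsmul (ZMod 4), ← Finset.sum_mul,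
      ← Finset.mul_sum]
    congr 3
    exact Fintype.sum_equiv (MulAction.toPerm h) _ _ fun x => rfl
  have h0 : (∑ x, (e g x - P)) * ∑ x, (e h x - Q) = 0 :=
    mul_eq_zero_of_mapMatrix_eq_zero (by rw [map_sum]; simp [hα]) (by rw [map_sum]; simp [hβ])
  rw [hgh, hg, hh, smul_mul_smul_comm, hX, one_smul]
  simp only [mul_add, add_mul, h0, smul_add, smul_mul_assoc, mul_smul_comm, smul_smul, hX, one_smul,
    add_zero]

/-- Lifts along `ℤ/4 → ℤ/2` can be constructed on an open subgroup of odd index. -/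
theorem exists_lift_of_odd_index [TopologicalSpace G] [IsTopologicalGroup G]
    (H : Subgroup G) (hH : IsOpen (H : Set G)) (hodd : Odd H.index)
    (ρ : G →* GL n (ZMod 2)) (σ : H →* GL n (ZMod 4))
    (hσρ : ∀ h : H, Matrix.GeneralLinearGroup.map redFourTwo (σ h) = ρ h)
    (hσ : ∀ᶠ u in 𝓝 1, σ u = 1) :
    ∃ ρ₂ : G →* GL n (ZMod 4), (∀ᶠ u in 𝓝 1, ρ₂ u = 1) ∧
      ∀ g, Matrix.GeneralLinearGroup.map redFourTwo (ρ₂ g) = ρ g := by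
  classical
  have : H.FiniteIndex := ⟨hodd.pos.ne'⟩
  let _ : Fintype (G ⧸ H) := Fintype.ofFinite _
  have hcard : ((Fintype.card (G ⧸ H) : ℕ) : ZMod 4) * (Fintype.card (G ⧸ H) : ℕ) = 1 := by
    rw [← Nat.card_eq_fintype_card]
    change ((H.index : ℕ) : ZMod 4) * (H.index : ℕ) = 1
    obtain ⟨k, hk⟩ := hodd
    rw [hk]
    push_cast
    generalize (k : ZMod 4) = a
    revert a
    decide
  choose u hu using exists_GL_lift (n := n)
  let r : G → G := fun g => (QuotientGroup.mk g : G ⧸ H).out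
  have hr : ∀ g, (r g)⁻¹ * g ∈ H := fun g => by
    rw [← QuotientGroup.eq]
    exact QuotientGroup.out_eq' _
  have hrmul : ∀ g (h : H), r (g * h) = r g := fun g h => by
    simp only [r, QuotientGroup.mk_mul_of_mem g h.2]
  let s : G → GL n (ZMod 4) := fun g => u (ρ (r g)) * σ ⟨(r g)⁻¹ * g, hr g⟩
  have hsρ : ∀ g, Matrix.GeneralLinearGroup.map redFourTwo (s g) = ρ g := fun g => by
    simp only [s]
    rw [map_mul, hu, hσρ, ← map_mul]
    simp
  have hsmul : ∀ g (h : H), s (g * h) = s g * σ h := fun g h => by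
    simp only [s]
    rw [mul_assoc, ← map_mul]
    congr 2
    · rw [hrmul]
    · apply Subtype.ext
      simp [hrmul, mul_assoc]
  let E : G → (G ⧸ H) → GL n (ZMod 4) := fun g x => s (g * x.out) * (s x.out)⁻¹
  have hE : ∀ g k, E g (QuotientGroup.mk k) = s (g * k) * (s k)⁻¹ := fun g k => by
    obtain ⟨h, hh⟩ := QuotientGroup.mk_out_eq_mul H k
    simp only [E]
    rw [hh, ← mul_assoc, hsmul, hsmul]
    group
  have hEρ : ∀ g x, Matrix.GeneralLinearGroup.map redFourTwo (E g x) = ρ g := fun g x => by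
    simp only [E]
    rw [map_mul, map_inv, hsρ, hsρ, map_mul]
    group
  have hEmul : ∀ g h x, E (g * h) x = E g (h • x) * E h x := fun g h x => by
    induction x using QuotientGroup.induction_on with
    | H k =>
      rw [MulAction.Quotient.smul_mk, hE, hE, hE]
      simp [mul_assoc]
  have hE1 : ∀ᶠ v in 𝓝 1, ∀ x, E v x = 1 := by
    rw [eventually_all]
    intro x
    induction x using QuotientGroup.induction_on with
    | H k =>
      have h1 : ∀ᶠ v in 𝓝 (1 : G), ∃ hv : v ∈ H, σ ⟨v, hv⟩ = 1 := by
        have := (hH.isOpenEmbedding_subtypeVal.map_nhds_eq (1 : H))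
        rw [show ((1 : H) : G) = 1 from rfl] at this
        rw [← this, eventually_map]
        filter_upwards [hσ] with v hv using ⟨v.2, hv⟩
      filter_upwards [(tendsto_conj_one k).eventually h1] with v ⟨hv, hv1⟩
      have : v * k = k * (⟨k⁻¹ * v * k, hv⟩ : H) := by
        simp [mul_assoc]
      rw [hE, this, hsmul, hv1, mul_one, mul_inv_cancel]
  let N : ZMod 4 := (Fintype.card (G ⧸ H) : ZMod 4)
  have havg1 : ∀ v, (∀ x, E v x = 1) →
      N • ∑ x, (E v x : Matrix n n (ZMod 4)) = 1 := fun v hv => by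
    simp only [hv, Units.val_one, Finset.sum_const, Finset.card_univ]
    rw [← Nat.cast_smul_eq_nsmul (ZMod 4), smul_smul]
    rw [hcard, one_smul]
  let τ : G →* Matrix n n (ZMod 4) :=
    { toFun := fun g => N • ∑ x, (E g x : Matrix n n (ZMod 4))
      map_one' := havg1 1 fun x => by simp [E]
      map_mul' := average_mul hcard (fun g => (ρ g : Matrix n n (ZMod 2))) _
        (fun g x => congrArg Units.val (hEρ g x))
        (fun g h x => by rw [hEmul, Units.val_mul]) }
  refine ⟨τ.toHomUnits, ?_, ?_⟩
  · filter_upwards [hE1] with v hv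
    exact Units.ext (havg1 v hv)
  · intro g
    apply Units.ext
    change redFourTwo.mapMatrix (N • ∑ x, (E g x : Matrix n n (ZMod 4))) = _
    have h1 : ∀ x, redFourTwo.mapMatrix (E g x : Matrix n n (ZMod 4)) = ρ g := fun x =>
      congrArg Units.val (hEρ g x)
    have h2 : N • ∑ x, (E g x : Matrix n n (ZMod 4)) =
        (Fintype.card (G ⧸ H)) • ∑ x, (E g x : Matrix n n (ZMod 4)) :=
      Nat.cast_smul_eq_nsmul _ _ _
    have h3 : ((Fintype.card (G ⧸ H) : ℕ) : ZMod 2) = 1 := by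
      have := congrArg redFourTwo hcard
      rw [map_mul, map_natCast, map_one] at this
      exact (by decide : ∀ a : ZMod 2, a * a = 1 → a = 1) _ this
    rw [h2, map_nsmul, map_sum, Finset.sum_congr rfl fun x _ => h1 x, Finset.sum_const,
      Finset.card_univ, ← Nat.cast_smul_eq_nsmul (ZMod 2), ← Nat.cast_smul_eq_nsmul (ZMod 2), h3,
      one_smul, one_smul]

end Averaging

section Block

variable {α β : Type}

/-- The permutation matrix of `a`, sending the basis vector `j` to `a j`. -/
def permMat [DecidableEq α] (R : Type) [CommRing R] (a : Equiv.Perm α) : Matrix α α R :=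
  Matrix.of fun i j => if i = a j then 1 else 0

lemma permMat_mul_apply [Fintype α] [DecidableEq α] {R : Type} [CommRing R]
    (a : Equiv.Perm α) (M : Matrix α β R) (i : α)
    (j : β) : (permMat R a * M) i j = M (a⁻¹ i) j := by
  simp [permMat, Matrix.mul_apply, ← Equiv.Perm.inv_eq_iff_eq]

lemma mul_permMat_apply [Fintype β] [DecidableEq β] {R : Type} [CommRing R]
    (b : Equiv.Perm β) (M : Matrix α β R) (i : α)
    (j : β) : (M * permMat R b) i j = M i (b j) := by
  simp [permMat, Matrix.mul_apply]

lemma permMat_mul [Fintype α] [DecidableEq α] {R : Type} [CommRing R] (a b : Equiv.Perm α) :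
    permMat R (a * b) = permMat R a * permMat R b := by
  ext i j
  rw [mul_permMat_apply]
  rfl

lemma permMat_one [DecidableEq α] {R : Type} [CommRing R] : permMat R (1 : Equiv.Perm α) = 1 := by
  ext i j
  rw [Matrix.one_apply]
  rfl

lemma permMat_injective [DecidableEq α] {R : Type} [CommRing R] [Nontrivial R] :
    Function.Injective (permMat R : Equiv.Perm α → _) := by
  intro a b h
  ext j
  have := congrFun (congrFun h (a j)) j
  by_contra hne
  simp [permMat, hne] at this

/-- Block upper triangular matrices with (twisted) permutation matrices on the diagonal. -/
def blockMat [DecidableEq α] [DecidableEq β] {R : Type} [CommRing R] (c : Rˣ) (a : Equiv.Perm α) (b : Equiv.Perm β)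
    (B : Matrix α β R) : Matrix (α ⊕ β) (α ⊕ β) R :=
  Matrix.fromBlocks ((c : R) • permMat R a) B 0 (permMat R b)

lemma blockMat_one [DecidableEq α] [DecidableEq β] {R : Type} [CommRing R] :
    blockMat (1 : Rˣ) (1 : Equiv.Perm α) (1 : Equiv.Perm β) 0 = 1 := by
  simp [blockMat, permMat_one]

lemma blockMat_inj [DecidableEq α] [DecidableEq β] {R : Type} [CommRing R] [Nontrivial R]
    {a a' : Equiv.Perm α}
    {b b' : Equiv.Perm β} {B B' : Matrix α β R}
    (h : blockMat (1 : Rˣ) a b B = blockMat 1 a' b' B') : a = a' ∧ b = b' ∧ B = B' := by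
  obtain ⟨h1, h2, -, h3⟩ := Matrix.fromBlocks_inj.mp h
  exact ⟨permMat_injective (by simpa using h1), permMat_injective h3, h2⟩

variable [Fintype α] [Fintype β] [DecidableEq α] [DecidableEq β]

lemma blockMat_mul {R : Type} [CommRing R] (c c' : Rˣ) (a a' : Equiv.Perm α) (b b' : Equiv.Perm β)
    (B B' : Matrix α β R) : blockMat c a b B * blockMat c' a' b' B' =
      blockMat (c * c') (a * a') (b * b') ((c : R) • (permMat R a * B') + B * permMat R b') := by
  simp [blockMat, Matrix.fromBlocks_multiply, permMat_mul, smul_smul, mul_comm]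

lemma blockMat_mul_inverse {R : Type} [CommRing R] (a : Equiv.Perm α) (b : Equiv.Perm β)
    (B : Matrix α β R) :
    blockMat (1 : Rˣ) a b B * blockMat 1 a⁻¹ b⁻¹ (-(permMat R a⁻¹ * B * permMat R b⁻¹)) = 1 := by
  rw [blockMat_mul, ← blockMat_one]
  have : permMat R a * (permMat R a⁻¹ * B * permMat R b⁻¹) = B * permMat R b⁻¹ := by
    rw [← Matrix.mul_assoc, ← Matrix.mul_assoc, ← permMat_mul, mul_inv_cancel, permMat_one,
      Matrix.one_mul]
  simp [this]

lemma mapMatrix_permMat (a : Equiv.Perm α) :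
    redFourTwo.mapMatrix (permMat (ZMod 4) a) = permMat (ZMod 2) a := by
  ext i j
  simp only [permMat, RingHom.mapMatrix_apply, Matrix.map_apply, Matrix.of_apply]
  split_ifs <;> simp

/-- The subgroup of block upper triangular matrices with permutation matrices on the diagonal. -/
def blockSubgroup (α β : Type) [Fintype α] [Fintype β] [DecidableEq α] [DecidableEq β]
    (R : Type) [CommRing R] : Subgroup (GL (α ⊕ β) R) where
  carrier := {M | ∃ a b B, (M : Matrix (α ⊕ β) (α ⊕ β) R) = blockMat 1 a b B}
  one_mem' := ⟨1, 1, 0, blockMat_one.symm⟩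
  mul_mem' := by
    rintro M M' ⟨a, b, B, h⟩ ⟨a', b', B', h'⟩
    refine ⟨a * a', b * b', permMat R a * B' + B * permMat R b', ?_⟩
    rw [Units.val_mul, h, h', blockMat_mul, one_mul, Units.val_one, one_smul]
  inv_mem' := by
    rintro M ⟨a, b, B, h⟩
    refine ⟨a⁻¹, b⁻¹, -(permMat R a⁻¹ * B * permMat R b⁻¹),
      Units.inv_eq_of_mul_eq_one_right ?_⟩
    rw [h]
    exact blockMat_mul_inverse a b B

lemma card_blockSubgroup (α β : Type) [Fintype α] [Fintype β] [DecidableEq α] [DecidableEq β]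
    (R : Type) [CommRing R] [Nontrivial R] : Nat.card (blockSubgroup α β R) =
      Nat.card (Equiv.Perm α × Equiv.Perm β × Matrix α β R) := by
  symm
  have hmul := fun x : Equiv.Perm α × Equiv.Perm β × Matrix α β R =>
    blockMat_mul_inverse x.1 x.2.1 x.2.2
  refine Nat.card_congr (Equiv.ofBijective
    (fun x => ⟨⟨_, _, hmul x, mul_eq_one_comm.mp (hmul x)⟩, x.1, x.2.1, x.2.2, rfl⟩) ⟨?_, ?_⟩)
  · rintro ⟨a, b, B⟩ ⟨a', b', B'⟩ h
    obtain ⟨rfl, rfl, rfl⟩ := blockMat_inj (congrArg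
      (fun M : blockSubgroup α β R => (M.1 : Matrix (α ⊕ β) (α ⊕ β) R)) h)
    rfl
  · rintro ⟨M, a, b, B, h⟩
    exact ⟨(a, b, B), Subtype.ext (Units.ext h.symm)⟩

variable {G : Type} [Group G] [TopologicalSpace G] [IsTopologicalGroup G]

/-- An extension of one permutation representation by another lifts modulo `4`. -/
theorem exists_lift_of_mem_blockSubgroup {χ : G →* (ZMod 4)ˣ} (hχ : ∀ᶠ u in 𝓝 1, χ u = 1)
    (hlift : ∀ S : Subgroup G, IsOpen (S : Set G) → HasModFourLifts (χ.comp S.subtype))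
    (ρ : G →* GL (α ⊕ β) (ZMod 2)) (hρ : ∀ᶠ u in 𝓝 1, ρ u = 1)
    (hmem : ∀ g, ρ g ∈ blockSubgroup α β (ZMod 2)) :
    ∃ σ : G →* GL (α ⊕ β) (ZMod 4), (∀ᶠ u in 𝓝 1, σ u = 1) ∧
      ∀ g, Matrix.GeneralLinearGroup.map redFourTwo (σ g) = ρ g := by
  choose a b B hB using hmem
  have h1 : ∀ u, ρ u = 1 → a u = 1 ∧ b u = 1 ∧ B u = 0 := fun u hu => by
    apply blockMat_inj (R := ZMod 2)
    rw [← hB, hu, blockMat_one, Units.val_one]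
  have hmul : ∀ g h, a (g * h) = a g * a h ∧ b (g * h) = b g * b h ∧
      B (g * h) = permMat (ZMod 2) (a g) * B h + B g * permMat (ZMod 2) (b h) := fun g h => by
    apply blockMat_inj (R := ZMod 2)
    rw [← hB, map_mul, Units.val_mul, hB, hB, blockMat_mul]
    simp
  let _ : MulAction G (α × β) :=
    { smul := fun g z => (a g z.1, b g z.2)
      one_smul := fun z => by
        change (a 1 z.1, b 1 z.2) = z
        simp [h1 1 (map_one ρ)]
      mul_smul := fun g h z => by
        change (a (g * h) z.1, b (g * h) z.2) = (a g (a h z.1), b g (b h z.2))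
        simp [hmul g h] }
  have hsmul : ∀ (g : G) (z : α × β), g • z = (a g z.1, b g z.2) := fun _ _ => rfl
  obtain ⟨Φ, hΦ, hΦ0, hΦφ⟩ := exists_lift_groupoid_cocycle (Z := α × β)
    (fun z => by
      filter_upwards [hρ] with u hu
      simp [hsmul, h1 u hu]) hχ hlift (fun g z => B g (a g z.1) z.2)
    (fun g h z => by
      rw [(hmul g h).2.2, Matrix.add_apply, permMat_mul_apply, mul_permMat_apply, (hmul g h).1,
        hsmul]
      simp [add_comm])
    (fun z => by
      filter_upwards [hρ] with u hu
      simp [h1 u hu])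
  let D : G → Matrix α β (ZMod 4) := fun g => Matrix.of fun i j => Φ g ((a g)⁻¹ i, j)
  have hone : ∀ u, ρ u = 1 → χ u = 1 → (∀ z, Φ u z = 0) →
      blockMat (χ u) (a u) (b u) (D u) = 1 := fun u hu hu' hz => by
    have hD : D u = 0 := by
      ext i j
      simp [D, hz]
    rw [hu', (h1 u hu).1, (h1 u hu).2.1, hD, blockMat_one]
  let τ : G →* Matrix (α ⊕ β) (α ⊕ β) (ZMod 4) :=
    { toFun := fun g => blockMat (χ g) (a g) (b g) (D g)
      map_one' := hone 1 (map_one ρ) (map_one χ) fun z => by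
        have := hΦ 1 1 z
        simpa using this
      map_mul' := fun g h => by
        rw [blockMat_mul, map_mul, (hmul g h).1, (hmul g h).2.1]
        congr 1
        ext i j
        rw [Matrix.add_apply, Matrix.smul_apply, permMat_mul_apply, mul_permMat_apply]
        simp only [D, Matrix.of_apply, (hmul g h).1, hΦ, hsmul, smul_eq_mul]
        simp [add_comm] }
  refine ⟨τ.toHomUnits, ?_, ?_⟩
  · filter_upwards [hρ, hχ, eventually_all.mpr hΦ0] with u hu hu' hz
    exact Units.ext (hone u hu hu' hz)
  · intro g
    apply Units.ext
    change redFourTwo.mapMatrix (blockMat (χ g) (a g) (b g) (D g)) = _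
    have hunit : ∀ c : (ZMod 4)ˣ, redFourTwo c = 1 := by decide
    have hD : (D g).map redFourTwo = B g := by
      ext i j
      simp only [D, Matrix.map_apply, Matrix.of_apply]
      rw [hΦφ]
      simp
    have hP := mapMatrix_permMat (a g)
    have hP' := mapMatrix_permMat (b g)
    rw [RingHom.mapMatrix_apply] at hP hP'
    rw [hB, RingHom.mapMatrix_apply, blockMat, blockMat, Matrix.fromBlocks_map, hD, hP']
    congr 1
    · rw [← hP]
      ext i j
      simp only [Matrix.map_apply, Matrix.smul_apply, smul_eq_mul, map_mul, hunit, Units.val_one]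

end Block

section Sylow

lemma odd_index_blockSubgroup : Odd (blockSubgroup (Fin 2) (Fin 2) (ZMod 2)).index := by
  have h1 := (blockSubgroup (Fin 2) (Fin 2) (ZMod 2)).index_mul_card
  have h2 : Nat.card (blockSubgroup (Fin 2) (Fin 2) (ZMod 2)) = 64 := by
    rw [card_blockSubgroup]
    simp [Nat.card_eq_fintype_card, Fintype.card_perm, Matrix]
  have h3 : Nat.card (GL (Fin 2 ⊕ Fin 2) (ZMod 2)) = 20160 := by
    rw [Nat.card_congr (Units.mapEquiv
      (Matrix.reindexAlgEquiv (ZMod 2) (ZMod 2) finSumFinEquiv).toMulEquiv).toEquiv]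
    have := Matrix.card_GL_field (𝔽 := ZMod 2) (n := 4)
    rw [this]
    simp [Fin.prod_univ_four]
  rw [h2, h3] at h1
  have : (blockSubgroup (Fin 2) (Fin 2) (ZMod 2)).index = 315 := by omega
  rw [this]
  decide

/-- A subgroup `Q` of odd index contains, up to conjugation, the image of a subgroup of odd
index. -/
lemma exists_odd_index_conj_mem {G Γ : Type} [Group G] [Group Γ] [Finite Γ] (ρ : G →* Γ)
    (Q : Subgroup Γ) (hQ : Odd Q.index) :
    ∃ H : Subgroup G, ρ.ker ≤ H ∧ Odd H.index ∧ ∃ x : Γ, ∀ h ∈ H, x⁻¹ * ρ h * x ∈ Q := by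
  have : Fact (Nat.Prime 2) := ⟨Nat.prime_two⟩
  obtain ⟨P⟩ : Nonempty (Sylow 2 ρ.range) := inferInstance
  refine ⟨(P : Subgroup ρ.range).comap ρ.rangeRestrict, ?_, ?_, ?_⟩
  · intro g hg
    have : ρ.rangeRestrict g = 1 := Subtype.ext hg
    rw [Subgroup.mem_comap, this]
    exact one_mem _
  · rw [Subgroup.index_comap_of_surjective _ ρ.rangeRestrict_surjective]
    rw [← Nat.not_even_iff_odd, even_iff_two_dvd]
    exact P.not_dvd_index
  · let _ : MulAction P (Γ ⧸ Q) :=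
      MulAction.compHom _ (ρ.range.subtype.comp (P : Subgroup ρ.range).subtype)
    obtain ⟨y, hy⟩ := P.isPGroup'.nonempty_fixed_point_of_prime_not_dvd_card (Γ ⧸ Q) (by
      rw [← even_iff_two_dvd, Nat.not_even_iff_odd]
      exact hQ)
    obtain ⟨x, rfl⟩ := QuotientGroup.mk_surjective y
    refine ⟨x, fun h hh => ?_⟩
    have h1 : (QuotientGroup.mk (ρ h * x) : Γ ⧸ Q) = QuotientGroup.mk x := hy ⟨_, hh⟩
    rw [mul_assoc, ← QuotientGroup.eq]
    exact h1.symm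

end Sylow

/-- Lifting for an arbitrary topological group with the lifting property for characters of its
open subgroups. -/
theorem exists_lift_GL_two_sum_two {G : Type} [Group G] [TopologicalSpace G] [IsTopologicalGroup G]
    {χ : G →* (ZMod 4)ˣ} (hχ : ∀ᶠ u in 𝓝 1, χ u = 1)
    (hlift : ∀ (L : Type) [Group L] [TopologicalSpace L] [IsTopologicalGroup L] (j : L →* G),
        IsOpenEmbedding j → HasModFourLifts (χ.comp j))
    (ρ : G →* GL (Fin 2 ⊕ Fin 2) (ZMod 2)) (hρ : ∀ᶠ u in 𝓝 1, ρ u = 1) :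
    ∃ ρ₂ : G →* GL (Fin 2 ⊕ Fin 2) (ZMod 4), (∀ᶠ u in 𝓝 1, ρ₂ u = 1) ∧
      ∀ g, Matrix.GeneralLinearGroup.map redFourTwo (ρ₂ g) = ρ g := by
  obtain ⟨H, hker, hodd, x, hx⟩ := exists_odd_index_conj_mem ρ _ odd_index_blockSubgroup
  have hH : IsOpen (H : Set G) := H.isOpen_of_mem_nhds (g := 1) (by
    filter_upwards [hρ] with u hu using hker hu)
  have hsub : Tendsto H.subtype (𝓝 1) (𝓝 1) := continuous_subtype_val.tendsto 1
  obtain ⟨σ, hσ, hσρ⟩ := exists_lift_of_mem_blockSubgroup (χ := χ.comp H.subtype)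
    (hsub.eventually hχ)
    (fun S hS => hlift S (H.subtype.comp S.subtype)
      (hH.isOpenEmbedding_subtypeVal.comp hS.isOpenEmbedding_subtypeVal))
    (((MulAut.conj x⁻¹).toMonoidHom.comp ρ).comp H.subtype)
    (by
      filter_upwards [hsub.eventually hρ] with u hu
      change x⁻¹ * ρ (H.subtype u) * x⁻¹⁻¹ = 1
      rw [hu]
      group)
    (fun h => by
      change x⁻¹ * ρ h * x⁻¹⁻¹ ∈ _
      rw [inv_inv]
      exact hx h h.2)
  obtain ⟨y, hy⟩ := exists_GL_lift x
  refine exists_lift_of_odd_index H hH hodd ρ ((MulAut.conj y).toMonoidHom.comp σ) ?_ ?_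
  · intro h
    change Matrix.GeneralLinearGroup.map redFourTwo (y * σ h * y⁻¹) = _
    rw [map_mul, map_mul, map_inv, hy, hσρ]
    change x * (x⁻¹ * ρ h * x⁻¹⁻¹) * x⁻¹ = _
    group
  · filter_upwards [hσ] with u hu
    change y * σ u * y⁻¹ = 1
    rw [hu]
    group

theorem stmt_3 (F : Type) [Field F]
    (ρ : AbsGal F →* GL (Fin 4) (ZMod 2))
    (hcont : IsOpen (ρ.ker : Set (AbsGal F))) :
    ∃ ρ₂ : AbsGal F →* GL (Fin 4) (ZMod 4),
      IsOpen (ρ₂.ker : Set (AbsGal F)) ∧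
      (Matrix.GeneralLinearGroup.map
        (ZMod.castHom (by norm_num : (2 : ℕ) ∣ 4) (ZMod 2))).comp ρ₂ = ρ := by
  obtain ⟨χ, hχ, hlift⟩ := exists_cyclotomic F
  let e : Fin 2 ⊕ Fin 2 ≃ Fin 4 := finSumFinEquiv
  let e₂ : GL (Fin 2 ⊕ Fin 2) (ZMod 2) ≃* GL (Fin 4) (ZMod 2) :=
    Units.mapEquiv (Matrix.reindexAlgEquiv (ZMod 2) (ZMod 2) e).toMulEquiv
  let e₄ : GL (Fin 2 ⊕ Fin 2) (ZMod 4) ≃* GL (Fin 4) (ZMod 4) :=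
    Units.mapEquiv (Matrix.reindexAlgEquiv (ZMod 4) (ZMod 4) e).toMulEquiv
  have hred : ∀ M, Matrix.GeneralLinearGroup.map redFourTwo (e₄ M) =
      e₂ (Matrix.GeneralLinearGroup.map redFourTwo M) := fun M => by
    ext i j
    rfl
  obtain ⟨σ, hσ, hσρ⟩ := exists_lift_GL_two_sum_two hχ hlift (e₂.symm.toMonoidHom.comp ρ) (by
    filter_upwards [hcont.mem_nhds (one_mem _)] with u hu
    change e₂.symm (ρ u) = 1
    rw [MonoidHom.mem_ker.mp hu, map_one])
  refine ⟨e₄.toMonoidHom.comp σ, Subgroup.isOpen_of_mem_nhds _ (g := 1) ?_, ?_⟩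
  · filter_upwards [hσ] with u hu
    change e₄ (σ u) = 1
    rw [hu, map_one]
  · apply MonoidHom.ext
    intro g
    change Matrix.GeneralLinearGroup.map redFourTwo (e₄ (σ g)) = ρ g
    rw [hred, hσρ]
    exact e₂.apply_symm_apply (ρ g)
end
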